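/- arXiv:2304.14007 — 2 statements merged into one kernel-verified Lean document; each statement's English description precedes it below -/
import Mathlib

section
/- Let I be a closed two-sided ideal of a C*-algebra A. Assume there exist m₀, m₁, n₀, n₁ ∈ ℕ such that wdiv_{2m₀}(m₀·[a]) ≤ n₀ for every positive a ∈ A/I and wdiv_{2m₁}(m₁·[b]) ≤ n₁ for every positive b ∈ I. Then wdiv_{2m₀m₁}((m₀m₁)·[c]) ≤ m₀(m₁n₀ + n₁) for every positive c ∈ A. Conversely, if sup over positive c ∈ A of wdiv_{2m}(m·[c]) ≤ n for some m, n ∈ ℕ, then wdiv_{2m}(m·[a]) ≤ n and wdiv_{2m}(m·[b]) ≤ n for every positive a ∈ A/I and positive b ∈ I. -/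
/-!
Common definitions: abstract Cuntz semigroups, divisibility, and C*-algebra notions
(nowhere scatteredness, σ-unitality, etc.) used to formalize the statements.
-/

open scoped MultiplierAlgebra ENNReal
open Filter Topology

noncomputable section

universe uu vv

/-- The (sequential) way-below relation `x ≪ y` (compact containment) in a partially
ordered set: whenever an increasing sequence has a supremum lying above `y`, some term
of the sequence already lies above `x`. -/
def WayBelow {S : Type*} [PartialOrder S] (x y : S) : Prop :=
  ∀ f : ℕ → S, Monotone f → ∀ s : S, IsLUB (Set.range f) s → y ≤ s → ∃ n, x ≤ f n

/-- An abstract Cuntz semigroup (`Cu`-semigroup): a positively ordered abelian monoid in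
which every increasing sequence has a supremum, every element is the supremum of a
`≪`-increasing sequence, addition preserves `≪`, and which satisfies the standard
axioms (O5) (almost algebraic order) and (O6) (almost Riesz decomposition), as well as
the existence of infima with idempotents `∞y = sup_n n•y` (all of these hold in the
Cuntz semigroup of any C*-algebra). -/
class CuSemigroup (S : Type*) extends AddCommMonoid S, PartialOrder S where
  add_le_add' : ∀ a b : S, a ≤ b → ∀ c : S, c + a ≤ c + b
  zero_le' : ∀ x : S, 0 ≤ x
  exists_isLUB : ∀ f : ℕ → S, Monotone f → ∃ s : S, IsLUB (Set.range f) s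
  exists_waybelow_seq : ∀ x : S, ∃ f : ℕ → S, Monotone f ∧
    (∀ n, WayBelow (f n) (f (n + 1))) ∧ IsLUB (Set.range f) x
  waybelow_add : ∀ {x y z w : S}, WayBelow x y → WayBelow z w → WayBelow (x + z) (y + w)
  /-- axiom (O5) -/
  almost_algebraic : ∀ x' x y' y z : S, WayBelow x' x → WayBelow y' y → x + y ≤ z →
    ∃ c : S, y' ≤ c ∧ x' + c ≤ z ∧ z ≤ x + c
  /-- axiom (O6) -/
  almost_riesz : ∀ x' x y z : S, WayBelow x' x → x ≤ y + z →
    ∃ v w : S, v ≤ x ∧ v ≤ y ∧ w ≤ x ∧ w ≤ z ∧ x' ≤ v + w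
  /-- `infty y = ∞·y = sup_n n•y` -/
  infty : S → S
  isLUB_infty : ∀ y : S, IsLUB (Set.range fun n : ℕ => n • y) (infty y)
  /-- the infimum `x ⊓ ∞y`, which exists in the Cuntz semigroup of any C*-algebra -/
  meetInfty : S → S → S
  isGLB_meetInfty : ∀ x y : S, IsGLB {x, infty y} (meetInfty x y)

namespace CuDiv

variable {S : Type*} [CuSemigroup S]

/-- `x` is weakly `(m, n)`-divisible. -/
def IsWeaklyDivisible (m n : ℕ) (x : S) : Prop :=
  ∀ x' : S, WayBelow x' x → ∃ y : Fin n → S, x' ≤ ∑ j, y j ∧ ∀ j, m • y j ≤ x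

/-- `x` is `(m, n)`-divisible. -/
def IsDivisible (m n : ℕ) (x : S) : Prop :=
  ∀ x' : S, WayBelow x' x → ∃ y : S, x' ≤ n • y ∧ m • y ≤ x

/-- `x` is weakly `(m, ω)`-divisible. -/
def IsWeaklyOmegaDivisible (m : ℕ) (x : S) : Prop :=
  ∀ x' : S, WayBelow x' x → ∃ (n : ℕ) (y : Fin n → S), x' ≤ ∑ j, y j ∧ ∀ j, m • y j ≤ x

/-- `x` is `(m, ω)`-divisible. -/
def IsOmegaDivisible (m : ℕ) (x : S) : Prop :=
  ∀ x' : S, WayBelow x' x → ∃ (y : S) (n : ℕ), x' ≤ n • y ∧ m • y ≤ x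

/-- `wdiv m x` is the least positive integer `n` such that `x` is weakly
`(m,n)`-divisible, and `∞` if there is no such `n`. -/
def wdiv (m : ℕ) (x : S) : ℕ∞ :=
  sInf {N : ℕ∞ | ∃ n : ℕ, 1 ≤ n ∧ N = n ∧ IsWeaklyDivisible m n x}

/-- `Div m x` is the least positive integer `n` such that `x` is `(m,n)`-divisible,
and `∞` if there is no such `n`. -/
def Div (m : ℕ) (x : S) : ℕ∞ :=
  sInf {N : ℕ∞ | ∃ n : ℕ, 1 ≤ n ∧ N = n ∧ IsDivisible m n x}

/-- An element `x` is strongly soft if for every `x' ≪ x` there is `t` with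
`x' + t ≤ x ≤ ∞t`. -/
def StronglySoft (x : S) : Prop :=
  ∀ x' : S, WayBelow x' x → ∃ t : S, x' + t ≤ x ∧ x ≤ CuSemigroup.infty t

/-- The Cuntz semigroup characterization of the Global Glimm Property: every element is
`(m, ω)`-divisible for every `m`. -/
def GlobalGlimm (S : Type*) [CuSemigroup S] : Prop :=
  ∀ (m : ℕ) (x : S), IsOmegaDivisible m x

/-- `Cu(A)` is left-soft separative. -/
def LeftSoftSeparative (S : Type*) [CuSemigroup S] : Prop :=
  ∀ x y t : S, StronglySoft x → WayBelow (x + t) (y + t) →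
    WayBelow t (CuSemigroup.infty y) → WayBelow t (CuSemigroup.infty x) → WayBelow x y

/-- `Cu(A)` is weakly cancellative. -/
def WeaklyCancellative (S : Type*) [CuSemigroup S] : Prop :=
  ∀ x y z : S, WayBelow (x + z) (y + z) → WayBelow x y

/-- `Cu(A)` has covering dimension zero. -/
def CoveringDimZero (S : Type*) [CuSemigroup S] : Prop :=
  ∀ x' x y₁ y₂ : S, WayBelow x' x → WayBelow x (y₁ + y₂) →
    ∃ z₁ z₂ : S, z₁ ≤ y₁ ∧ z₂ ≤ y₂ ∧ x' ≤ z₁ + z₂ ∧ z₁ + z₂ ≤ x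

end CuDiv

/-- A functional on a Cuntz semigroup: an additive, order preserving map to `ℝ≥0∞`
preserving suprema of increasing sequences.  (By Elliott–Robert–Santiago, the
functionals on `Cu(A)` are exactly those induced by the lower semicontinuous
2-quasitraces on `A ⊗ K`.) -/
structure CuFunctional (S : Type*) [CuSemigroup S] where
  toFun : S → ℝ≥0∞
  map_zero' : toFun 0 = 0
  map_add' : ∀ x y : S, toFun (x + y) = toFun x + toFun y
  mono' : ∀ x y : S, x ≤ y → toFun x ≤ toFun y
  sup' : ∀ f : ℕ → S, Monotone f → ∀ s : S, IsLUB (Set.range f) s →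
    toFun s = ⨆ n, toFun (f n)

instance {S : Type*} [CuSemigroup S] : CoeFun (CuFunctional S) fun _ => S → ℝ≥0∞ :=
  ⟨CuFunctional.toFun⟩

namespace CuDiv

variable {S : Type*} [CuSemigroup S]

/-- `x <ₛ y` : there is `γ < 1` with `λ(x) ≤ γ·λ(y)` for every functional `λ`. -/
def FunctionalLT (x y : S) : Prop :=
  ∃ γ : ℝ≥0∞, γ < 1 ∧ ∀ lam : CuFunctional S, lam x ≤ γ * lam y

/-- `A` has `k`-comparison (stated on `Cu(A)`). -/
def KComparison (S : Type*) [CuSemigroup S] (k : ℕ) : Prop :=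
  ∀ (x : S) (b : Fin (k + 1) → S), (∀ i, FunctionalLT x (b i)) → x ≤ ∑ i, b i

/-- `A` has strict comparison (stated on `Cu(A)`, via functionals, which correspond to
the lower semicontinuous 2-quasitraces). -/
def StrictComparison (S : Type*) [CuSemigroup S] : Prop :=
  ∀ x y : S, FunctionalLT x y → x ≤ y

/-- The natural topology on the cone `F(Cu(A))` of functionals. -/
def functionalTopology (S : Type*) [CuSemigroup S] : TopologicalSpace (CuFunctional S) :=
  TopologicalSpace.generateFrom
    ({U | ∃ (x : S) (r : ℝ≥0∞), U = {lam : CuFunctional S | r < lam x}} ∪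
      {U | ∃ (x' x : S) (r : ℝ≥0∞), WayBelow x' x ∧ U = {lam : CuFunctional S | lam x' < r}})

/-- A lower semicontinuous affine function on the cone of functionals of `Cu(A)`,
i.e. an element of `L(F(Cu(A)))`. -/
def IsLscAffine (F : CuFunctional S → ℝ≥0∞) : Prop :=
  (letI := functionalTopology S; LowerSemicontinuous F) ∧
    (∀ lam mu nu : CuFunctional S, (∀ x, nu x = lam x + mu x) → F nu = F lam + F mu) ∧
    (∀ (r : ℝ≥0∞) (lam nu : CuFunctional S), (∀ x, nu x = r * lam x) → F nu = r * F lam)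

/-- The rank map of `Cu(A)` is surjective: every lower semicontinuous affine function on
the cone of functionals is realized as the rank function `λ ↦ λ(x)` of an element. -/
def SurjectiveRankMap (S : Type*) [CuSemigroup S] : Prop :=
  ∀ F : CuFunctional S → ℝ≥0∞, IsLscAffine F → ∃ y : S, ∀ lam : CuFunctional S, lam y = F lam

end CuDiv

/-! ### C*-algebra notions -/

section CStar

variable {B : Type*} [NonUnitalCStarAlgebra B]

/-- Positivity in a C*-algebra: `a` is positive iff it is of the form `star b * b`. -/
def CStarNonneg (a : B) : Prop := ∃ b : B, a = star b * b

/-- Cuntz subequivalence `a ≼ b` : `a = lim_n rₙ b rₙ*`. -/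
def CuntzBelow (a b : B) : Prop :=
  ∃ r : ℕ → B, Tendsto (fun n => r n * b * star (r n)) atTop (𝓝 a)

/-- Cuntz equivalence. -/
def CuntzEquiv (a b : B) : Prop := CuntzBelow a b ∧ CuntzBelow b a

/-- `A` is σ-unital: it has a countable (norm-bounded, positive) approximate unit. -/
def SigmaUnital (A : Type*) [NonUnitalCStarAlgebra A] : Prop :=
  ∃ e : ℕ → A, (∀ n, CStarNonneg (e n) ∧ ‖e n‖ ≤ 1) ∧
    ∀ a : A, Tendsto (fun n => e n * a) atTop (𝓝 a) ∧ Tendsto (fun n => a * e n) atTop (𝓝 a)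

end CStar

/-- A closed two-sided (automatically star-closed) ideal of a C*-algebra. -/
structure ClosedTwoSidedIdealC (A : Type*) [NonUnitalCStarAlgebra A] where
  carrier : NonUnitalStarSubalgebra ℂ A
  isClosed : IsClosed (carrier : Set A)
  mul_mem_left : ∀ a : A, ∀ x ∈ carrier, a * x ∈ carrier
  mul_mem_right : ∀ a : A, ∀ x ∈ carrier, x * a ∈ carrier

section Reps

variable {A : Type*} [NonUnitalCStarAlgebra A]
variable {H : Type*} [NormedAddCommGroup H] [InnerProductSpace ℂ H] [CompleteSpace H]

/-- A (topologically) irreducible representation of `A` on a Hilbert space `H`. -/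
def IsIrreducibleRep (π : A →⋆ₙₐ[ℂ] (H →L[ℂ] H)) : Prop :=
  (∃ a : A, π a ≠ 0) ∧
    ∀ K : Submodule ℂ H, IsClosed (K : Set H) → (∀ a : A, ∀ v ∈ K, π a v ∈ K) →
      K = ⊥ ∨ K = ⊤

end Reps

/-- `A` has a nonzero elementary ideal-quotient `J/I`, expressed via a surjection of a
closed two-sided ideal `J` of `A` onto the algebra of compact operators on a Hilbert
space (the kernel `I` of such a `*`-homomorphism is automatically a closed two-sided
ideal of `A`, and conversely any nonzero elementary ideal-quotient arises this way). -/
def HasNonzeroElementaryIdealQuotient (A : Type*) [NonUnitalCStarAlgebra A] : Prop :=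
  ∃ (J : ClosedTwoSidedIdealC A) (H : Type) (_ : NormedAddCommGroup H)
    (_ : InnerProductSpace ℂ H) (_ : CompleteSpace H)
    (ψ : J.carrier →⋆ₙₐ[ℂ] (H →L[ℂ] H)),
      Set.range ψ = {T : H →L[ℂ] H | IsCompactOperator ⇑T} ∧ ∃ x, ψ x ≠ 0

/-- A C*-algebra is nowhere scattered if no ideal-quotient of it is nonzero and
elementary. -/
def NowhereScattered (A : Type*) [NonUnitalCStarAlgebra A] : Prop :=
  ¬ HasNonzeroElementaryIdealQuotient A

/-- A C*-algebra is elementary if it is isomorphic to the algebra of compact operators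
on some Hilbert space. -/
def IsElementaryCStar (A : Type*) [NonUnitalCStarAlgebra A] : Prop :=
  ∃ (H : Type) (_ : NormedAddCommGroup H) (_ : InnerProductSpace ℂ H) (_ : CompleteSpace H)
    (ψ : A →⋆ₙₐ[ℂ] (H →L[ℂ] H)),
      Function.Injective ψ ∧ Set.range ψ = {T : H →L[ℂ] H | IsCompactOperator ⇑T}

/-- A C*-algebra is simple if it is nonzero and has no nontrivial closed two-sided
ideals. -/
def IsSimpleCStar (A : Type*) [NonUnitalCStarAlgebra A] : Prop :=
  (∃ a : A, a ≠ 0) ∧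
    ∀ J : ClosedTwoSidedIdealC A, (J.carrier : Set A) = {0} ∨ (J.carrier : Set A) = Set.univ

/-- Real rank zero: the invertible self-adjoint elements are dense in the self-adjoint
part of the minimal unitization. -/
def RealRankZero (A : Type*) [NonUnitalCStarAlgebra A] : Prop :=
  ∀ x : Unitization ℂ A, IsSelfAdjoint x →
    x ∈ closure {y : Unitization ℂ A | IsSelfAdjoint y ∧ IsUnit y}

/-- Stable rank one: the invertible elements are dense in the minimal unitization. -/
def StableRankOne (A : Type*) [NonUnitalCStarAlgebra A] : Prop :=
  ∀ x : Unitization ℂ A, x ∈ closure {y : Unitization ℂ A | IsUnit y}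

section CP

variable {A B : Type*} [NonUnitalCStarAlgebra A] [NonUnitalCStarAlgebra B]

/-- A linear map between C*-algebras is completely positive if all of its matrix
amplifications preserve positivity. -/
def IsCompletelyPositive (φ : A →ₗ[ℂ] B) : Prop :=
  ∀ (n : ℕ) (a : Matrix (Fin n) (Fin n) A), (∃ b : Matrix (Fin n) (Fin n) A, a = star b * b) →
    ∃ c : Matrix (Fin n) (Fin n) B, a.map ⇑φ = star c * c

/-- A completely positive contractive (c.p.c.) map. -/
def IsCPC (φ : A →ₗ[ℂ] B) : Prop :=
  IsCompletelyPositive φ ∧ ∀ a : A, ‖φ a‖ ≤ ‖a‖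

/-- A map between C*-algebras has order zero if it preserves orthogonality of positive
elements. -/
def IsOrderZero (φ : A →ₗ[ℂ] B) : Prop :=
  ∀ a b : A, CStarNonneg a → CStarNonneg b → a * b = 0 → φ a * φ b = 0

end CP

/-- `A` has nuclear dimension at most `k`: there are c.p.c. approximations of the
identity through finite dimensional C*-algebras in which the downwards maps are sums of
`k+1` c.p.c. order zero maps. -/
def NuclearDimLE (A : Type*) [NonUnitalCStarAlgebra A] (k : ℕ) : Prop :=
  ∀ (F : Finset A) (ε : ℝ), 0 < ε →
    ∃ (Fd : Type) (_ : NonUnitalCStarAlgebra Fd) (_ : FiniteDimensional ℂ Fd)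
      (ψ : A →ₗ[ℂ] Fd) (φ : Fin (k + 1) → (Fd →ₗ[ℂ] A)),
        IsCPC ψ ∧ (∀ i, IsCPC (φ i) ∧ IsOrderZero (φ i)) ∧
        ∀ a ∈ F, ‖(∑ i, φ i (ψ a)) - a‖ ≤ ε

section Prim

variable (A : Type*) [NonUnitalCStarAlgebra A]

/-- A primitive ideal: the kernel of an irreducible representation. -/
def IsPrimitiveIdeal {A : Type*} [NonUnitalCStarAlgebra A] (J : ClosedTwoSidedIdealC A) : Prop :=
  ∃ (H : Type) (_ : NormedAddCommGroup H) (_ : InnerProductSpace ℂ H) (_ : CompleteSpace H)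
    (π : A →⋆ₙₐ[ℂ] (H →L[ℂ] H)),
      IsIrreducibleRep π ∧ ∀ a : A, a ∈ J.carrier ↔ π a = 0

/-- The primitive ideal space of `A`. -/
def PrimIdealSpace := {J : ClosedTwoSidedIdealC A // IsPrimitiveIdeal J}

/-- The hull-kernel (Jacobson) topology on the primitive ideal space. -/
instance : TopologicalSpace (PrimIdealSpace A) :=
  TopologicalSpace.generateFrom {U | ∃ a : A, U = {P : PrimIdealSpace A | a ∉ P.1.carrier}}

/-- `A` has topological dimension zero: the primitive ideal space has a basis of
compact open sets. -/
def TopDimZero : Prop :=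
  ∃ 𝒷 : Set (Set (PrimIdealSpace A)), TopologicalSpace.IsTopologicalBasis 𝒷 ∧
    ∀ U ∈ 𝒷, IsCompact U ∧ IsOpen U

end Prim

section Proj

variable {B : Type*} [NonUnitalCStarAlgebra B]

/-- A projection in a C*-algebra. -/
def IsProjectionElem (p : B) : Prop := IsSelfAdjoint p ∧ p * p = p

/-- `B` contains an infinite projection: a projection which is Murray-von Neumann
equivalent to a proper subprojection of itself. -/
def HasInfiniteProjection (B : Type*) [NonUnitalCStarAlgebra B] : Prop :=
  ∃ p v : B, IsProjectionElem p ∧ star v * v = p ∧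
    p * (v * star v) = v * star v ∧ v * star v ≠ p

end Proj

/-! ### The Cuntz semigroup of a C*-algebra -/

/-- Padding a matrix by one extra row and column of zeros. -/
def matPad {A : Type*} [Zero A] {n : ℕ} (a : Matrix (Fin n) (Fin n) A) :
    Matrix (Fin (n + 1)) (Fin (n + 1)) A :=
  Matrix.of fun i j =>
    if h : (i : ℕ) < n ∧ (j : ℕ) < n then a ⟨i, h.1⟩ ⟨j, h.2⟩ else 0

/-- A witness that `S` is the Cuntz semigroup of the C*-algebra `A`: it provides a
stabilization `stab` of `A` (a model of `A ⊗ K`, described as the C*-completion of the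
union of the matrix algebras `Mₙ(A)`), together with the class map
`cls : (stab)₊ → S = Cu(A)` identifying `S` with the set of Cuntz equivalence classes of
positive elements of `A ⊗ K`, with order induced by Cuntz subequivalence, addition
induced by orthogonal (diagonal) addition, and with the compact containment relation
`≪` given by `x ≪ [a]` iff `x ≤ [(a - ε)₊]` for some `ε > 0`. -/
structure IsCuntzSemigroupOf (A : Type uu) [NonUnitalCStarAlgebra A]
    (S : Type vv) [CuSemigroup S] where
  stab : Type (max uu vv)
  [stabCStar : NonUnitalCStarAlgebra stab]
  matEmb : (n : ℕ) → (Matrix (Fin n) (Fin n) A →⋆ₙₐ[ℂ] stab)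
  matEmb_injective : ∀ n, Function.Injective (matEmb n)
  matEmb_compat : ∀ (n : ℕ) (a : Matrix (Fin n) (Fin n) A), matEmb (n + 1) (matPad a) = matEmb n a
  matEmb_dense : Dense (⋃ n, Set.range (matEmb n))
  cls : stab → S
  cls_zero : cls 0 = 0
  cls_surj : ∀ s : S, ∃ b : stab, CStarNonneg b ∧ cls b = s
  cls_le_iff : ∀ a b : stab, CStarNonneg a → CStarNonneg b → (cls a ≤ cls b ↔ CuntzBelow a b)
  cls_add_orth : ∀ a b : stab, CStarNonneg a → CStarNonneg b → a * b = 0 →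
    cls (a + b) = cls a + cls b
  exists_orth : ∀ a b : stab, CStarNonneg a → CStarNonneg b →
    ∃ a' b' : stab, CStarNonneg a' ∧ CStarNonneg b' ∧ a' * b' = 0 ∧
      cls a' = cls a ∧ cls b' = cls b
  waybelow_iff : ∀ (x : S) (a : stab), CStarNonneg a →
    (WayBelow x (cls a) ↔ ∃ ε : ℝ, 0 < ε ∧ x ≤ cls (cfcₙ (fun t : ℝ => max (t - ε) 0) a))

attribute [instance] IsCuntzSemigroupOf.stabCStar

/-- The Cuntz class `[a] ∈ Cu(A)` of an element `a` of `A` itself (via the canonical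
embedding `A ≅ M₁(A) ⊆ A ⊗ K`). -/
def IsCuntzSemigroupOf.clsA {A : Type*} [NonUnitalCStarAlgebra A] {S : Type*} [CuSemigroup S]
    (h : IsCuntzSemigroupOf A S) (a : A) : S :=
  h.cls (h.matEmb 1 (Matrix.of fun _ _ => a))

/-- `B` has a surjective rank map (every lower semicontinuous affine function on the
cone of functionals on `Cu(B)` is realized as a rank function). -/
def HasSurjectiveRankMap (B : Type*) [NonUnitalCStarAlgebra B] : Prop :=
  ∀ (S : Type) (inst : CuSemigroup S), IsCuntzSemigroupOf B S → CuDiv.SurjectiveRankMap S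

/-- The family of separable sub-C*-algebras of `A` having a surjective rank map. -/
def sepSurjRankFamily (A : Type*) [NonUnitalCStarAlgebra A] :
    Set (NonUnitalStarSubalgebra ℂ A) :=
  {B | ∃ _h : IsClosed (B : Set A),
    TopologicalSpace.SeparableSpace B ∧ HasSurjectiveRankMap B}

/-- The family of separable sub-C*-algebras of `A` with a surjective rank map is
σ-complete (closed under countable increasing unions) and cofinal (every separable
sub-C*-algebra is contained in a member). -/
def SepSurjRankFamilySigmaCompleteCofinal (A : Type*) [NonUnitalCStarAlgebra A] : Prop :=
  (∀ Bseq : ℕ → NonUnitalStarSubalgebra ℂ A, Monotone Bseq →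
    (∀ n, Bseq n ∈ sepSurjRankFamily A) →
      (⨆ n, Bseq n).topologicalClosure ∈ sepSurjRankFamily A) ∧
  (∀ C : NonUnitalStarSubalgebra ℂ A, IsClosed (C : Set A) →
    TopologicalSpace.SeparableSpace C → ∃ B ∈ sepSurjRankFamily A, C ≤ B)

end

/-! ### Comparison lemmas in C*-algebras -/

section Comparison

variable {D : Type*} [NonUnitalCStarAlgebra D]

section Order

variable [PartialOrder D] [StarOrderedRing D]

theorem cStarNonneg_iff_nonneg {a : D} : CStarNonneg a ↔ 0 ≤ a :=
  CStarAlgebra.nonneg_iff_eq_star_mul_self.symm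

open CStarAlgebra in
/-- If `0 ≤ x ≤ y`, then `x` is approximated by `s * y * star s` with `s` a contraction. -/
theorem exists_conj_approx_of_le {x y : D} (hx : 0 ≤ x) (hxy : x ≤ y) {ε : ℝ} (hε : 0 < ε) :
    ∃ s : D, ‖s‖ ≤ 1 ∧ ‖x - s * y * star s‖ ≤ ε := by
  have hx' : (0 : Unitization ℂ D) ≤ (x : Unitization ℂ D) := Unitization.inr_nonneg_iff.2 hx
  have hy' : (0 : Unitization ℂ D) ≤ (y : Unitization ℂ D) :=
    Unitization.inr_nonneg_iff.2 (hx.trans hxy)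
  have hxy' : (x : Unitization ℂ D) ≤ (y : Unitization ℂ D) :=
    (Unitization.inr_le_iff x y (.of_nonneg hx) (.of_nonneg (hx.trans hxy))).2 hxy
  set z : Unitization ℂ D := (y : Unitization ℂ D) + algebraMap ℝ _ ε with hz
  have hε' : IsStrictlyPositive (algebraMap ℝ (Unitization ℂ D) ε) := by
    rw [IsStrictlyPositive.iff_of_unital]
    exact ⟨algebraMap_nonneg _ hε.le, (IsUnit.mk0 ε hε.ne').map (algebraMap ℝ _)⟩
  have hzpos : IsStrictlyPositive z := .nonneg_add hy' hε'
  set w : Unitization ℂ D := z ^ (-(1 / 2) : ℝ) with hw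
  have hwsa : IsSelfAdjoint w := .of_nonneg CFC.rpow_nonneg
  have hnorm : ‖CFC.sqrt (x : Unitization ℂ D) * w‖ ≤ 1 :=
    (le_iff_norm_sqrt_mul_rpow _ z hx' hzpos).1
      (hxy'.trans (le_add_of_nonneg_right hε'.nonneg))
  obtain ⟨s, hs⟩ : ∃ s : D, (s : Unitization ℂ D) = CFC.sqrt (x : Unitization ℂ D) * w := by
    refine ⟨(CFC.sqrt (x : Unitization ℂ D) * w).snd, ?_⟩
    rw [Unitization.sqrt_inr]
    ext <;> simp
  have hsq : IsSelfAdjoint (CFC.sqrt (x : Unitization ℂ D)) := .of_nonneg (CFC.sqrt_nonneg _)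
  refine ⟨s, by rw [← Unitization.norm_inr (𝕜 := ℂ), hs]; exact hnorm, ?_⟩
  have key : ((x - s * y * star s : D) : Unitization ℂ D) =
      ε • ((s : Unitization ℂ D) * star (s : Unitization ℂ D)) := by
    have h1 : (s : Unitization ℂ D) * z * star (s : Unitization ℂ D) = x := by
      rw [hs, star_mul, hwsa.star_eq, hsq.star_eq]
      calc _ = CFC.sqrt (x : Unitization ℂ D) * (w * z * w) * CFC.sqrt (x : Unitization ℂ D) := by
            simp only [mul_assoc]
        _ = x := by
            rw [hw, CFC.conjugate_rpow_neg_one_half z hzpos, mul_one,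
              CFC.sqrt_mul_sqrt_self _ hx']
    have h2 : (s : Unitization ℂ D) * y * star (s : Unitization ℂ D) =
        x - ε • ((s : Unitization ℂ D) * star (s : Unitization ℂ D)) := by
      rw [← h1, hz, mul_add, add_mul, Algebra.algebraMap_eq_smul_one, mul_smul_comm, mul_one,
        smul_mul_assoc, add_sub_cancel_right]
    rw [Unitization.inr_sub, Unitization.inr_mul, Unitization.inr_mul, Unitization.inr_star, h2]
    abel
  rw [← Unitization.norm_inr (𝕜 := ℂ), key, norm_smul, CStarRing.norm_self_mul_star, hs,
    Real.norm_of_nonneg hε.le]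
  exact mul_le_of_le_one_right hε.le (mul_le_one₀ hnorm (norm_nonneg _) hnorm)

/-- Rørdam's lemma: if `‖a - b‖ ≤ δ < η`, then `(a - η)₊` is Cuntz below `b`. -/
theorem exists_conj_approx_cutdown {a b : D} (ha : 0 ≤ a) (hb : 0 ≤ b) {δ η : ℝ} (hδ : 0 ≤ δ)
    (hδη : δ < η) (hab : ‖a - b‖ ≤ δ) {ε : ℝ} (hε : 0 < ε) :
    ∃ s : D, ‖cfcₙ (fun t : ℝ => max (t - η) 0) a - s * b * star s‖ ≤ ε := by
  have hη : 0 < η := hδ.trans_lt hδη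
  have hmax : ∀ t : ℝ, 0 < max (t - δ) (η - δ) := fun t =>
    lt_of_lt_of_le (sub_pos.2 hδη) (le_max_right _ _)
  obtain ⟨g, hgc, hg0, hgg⟩ : ∃ g : ℝ → ℝ, Continuous g ∧ g 0 = 0 ∧
      ∀ t, g t * g t * (t - δ) = max (t - η) 0 := by
    refine ⟨fun t => √(max (t - η) 0 / max (t - δ) (η - δ)),
      Real.continuous_sqrt.comp
        (Continuous.div (by fun_prop) (by fun_prop) fun t => (hmax t).ne'),
      by simp [hη.le], fun t => ?_⟩
    rw [Real.mul_self_sqrt (div_nonneg (le_max_right _ _) (hmax t).le)]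
    rcases le_total t η with h | h
    · rw [max_eq_right (by linarith : t - η ≤ 0)]; simp
    · rw [max_eq_left (by linarith : η - δ ≤ t - δ), div_mul_cancel₀]
      linarith
  have hasa : IsSelfAdjoint a := .of_nonneg ha
  have hbsa : IsSelfAdjoint b := .of_nonneg hb
  set G := cfcₙ g a with hG
  have hGsa : IsSelfAdjoint G := cfcₙ_predicate g a
  have hsub : cfcₙ (fun t : ℝ => max (t - η) 0) a = G * a * G - δ • (G * G) := by
    have e1 : G * a * G = cfcₙ (fun t => g t * t * g t) a := by
      rw [cfcₙ_mul (fun t => g t * t) g a, cfcₙ_mul g (fun t => t) a, cfcₙ_id' ℝ a]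
    have e2 : δ • (G * G) = cfcₙ (fun t => δ • (g t * g t)) a := by
      rw [cfcₙ_smul δ (fun t => g t * g t) a, cfcₙ_mul g g a]
    rw [e1, e2, ← cfcₙ_sub (fun t => g t * t * g t) (fun t => δ • (g t * g t)) a]
    congr 1
    ext t
    rw [← hgg t, smul_eq_mul]
    ring
  have hpos : 0 ≤ cfcₙ (fun t : ℝ => max (t - η) 0) a :=
    cfcₙ_nonneg fun t _ => le_max_right _ _
  have hle : cfcₙ (fun t : ℝ => max (t - η) 0) a ≤ G * b * G := by
    have h1 : star G * (a - b) * G ≤ ‖a - b‖ • (star G * G) :=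
      CStarAlgebra.star_left_conjugate_le_norm_smul (hasa.sub hbsa)
    have h2 : ‖a - b‖ • (star G * G) ≤ δ • (star G * G) :=
      smul_le_smul_of_nonneg_right hab (star_mul_self_nonneg G)
    have h3 := h1.trans h2
    rw [hGsa.star_eq, mul_sub, sub_mul, sub_le_iff_le_add] at h3
    rw [hsub, sub_le_iff_le_add, add_comm]
    exact h3
  obtain ⟨s, -, hs⟩ := exists_conj_approx_of_le hpos hle hε
  refine ⟨s * G, ?_⟩
  rw [star_mul, hGsa.star_eq]
  simpa only [mul_assoc] using hs

theorem norm_sub_cutdown_le {a : D} (ha : 0 ≤ a) {η : ℝ} (hη : 0 ≤ η) :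
    ‖a - cfcₙ (fun t : ℝ => max (t - η) 0) a‖ ≤ η := by
  have hasa : IsSelfAdjoint a := .of_nonneg ha
  have h0 : (fun t : ℝ => max (t - η) 0) 0 = 0 := by simp [hη]
  nth_rewrite 1 [← cfcₙ_id' ℝ a]
  rw [← cfcₙ_sub (fun t : ℝ => t) (fun t : ℝ => max (t - η) 0) a]
  refine norm_cfcₙ_le fun t ht => ?_
  have ht0 : 0 ≤ t := quasispectrum_nonneg_of_nonneg a ha t ht
  rw [Real.norm_eq_abs, abs_le]
  rcases le_total t η with h | h
  · rw [max_eq_right (by linarith : t - η ≤ 0)]; constructor <;> linarith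
  · rw [max_eq_left (by linarith : 0 ≤ t - η)]; constructor <;> linarith

end Order

/-- A self-adjoint `a` is approximated by `(k * a) * a * star (k * a)`. -/
theorem exists_mul_self_approx {a : D} (ha : IsSelfAdjoint a) {ε : ℝ} (hε : 0 < ε) :
    ∃ k : D, ‖k * a * a * star (k * a) - a‖ ≤ ε := by
  have hden : ∀ t : ℝ, 0 < t ^ 2 + ε ^ 2 := fun t => by positivity
  obtain ⟨f, hf, hfc, hf0⟩ : ∃ f : ℝ → ℝ, (∀ t, f t = t / (t ^ 2 + ε ^ 2)) ∧ Continuous f ∧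
      f 0 = 0 :=
    ⟨fun t => t / (t ^ 2 + ε ^ 2), fun _ => rfl,
      Continuous.div (by fun_prop) (by fun_prop) fun t => (hden t).ne', by simp⟩
  refine ⟨cfcₙ f a, ?_⟩
  have hsa : IsSelfAdjoint (cfcₙ f a) := cfcₙ_predicate f a
  rw [star_mul, hsa.star_eq, ha.star_eq]
  have e1 : cfcₙ f a * a * a * (a * cfcₙ f a) - a =
      cfcₙ (fun t => f t * t * t * (t * f t) - t) a := by
    rw [cfcₙ_sub (fun t => f t * t * t * (t * f t)) (fun t => t) a,
      cfcₙ_mul (fun t => f t * t * t) (fun t => t * f t) a,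
      cfcₙ_mul (fun t => f t * t) (fun t => t) a, cfcₙ_mul f (fun t => t) a,
      cfcₙ_mul (fun t => t) f a, cfcₙ_id' ℝ a]
  rw [e1]
  refine norm_cfcₙ_le fun t _ => ?_
  have h1 : f t * t * t * (t * f t) - t =
      -(t * ε ^ 2 * (2 * t ^ 2 + ε ^ 2)) / (t ^ 2 + ε ^ 2) ^ 2 := by
    have := (hden t).ne'
    rw [hf]
    field_simp
    ring
  rw [h1, Real.norm_eq_abs, abs_div, abs_of_pos (by positivity : 0 < (t ^ 2 + ε ^ 2) ^ 2),
    div_le_iff₀ (by positivity), abs_neg, abs_mul, abs_mul,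
    abs_of_pos (by positivity : 0 < ε ^ 2), abs_of_pos (by positivity : 0 < 2 * t ^ 2 + ε ^ 2)]
  have h2 : 2 * |t| * ε ≤ t ^ 2 + ε ^ 2 := by
    rw [← sq_abs t]; nlinarith [sq_nonneg (|t| - ε)]
  have h3 : 2 * t ^ 2 + ε ^ 2 ≤ 2 * (t ^ 2 + ε ^ 2) := by nlinarith [sq_nonneg ε]
  calc |t| * ε ^ 2 * (2 * t ^ 2 + ε ^ 2) ≤ |t| * ε ^ 2 * (2 * (t ^ 2 + ε ^ 2)) := by gcongr
    _ = ε * (2 * |t| * ε) * (t ^ 2 + ε ^ 2) := by ring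
    _ ≤ ε * (t ^ 2 + ε ^ 2) * (t ^ 2 + ε ^ 2) := by gcongr
    _ = ε * (t ^ 2 + ε ^ 2) ^ 2 := by ring

end Comparison

/-! ### Cuntz subequivalence in terms of norm estimates -/

section Cuntz

variable {D : Type*} [NonUnitalCStarAlgebra D]

theorem cuntzBelow_iff_forall_exists_norm_lt {a b : D} :
    CuntzBelow a b ↔ ∀ ε : ℝ, 0 < ε → ∃ r : D, ‖r * b * star r - a‖ < ε := by
  constructor
  · rintro ⟨r, hr⟩ ε hε
    obtain ⟨n, hn⟩ := ((tendsto_iff_norm_sub_tendsto_zero.1 hr).eventually_lt_const hε).exists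
    exact ⟨r n, hn⟩
  · intro h
    choose r hr using fun n : ℕ => h (1 / ((n : ℝ) + 1)) Nat.one_div_pos_of_nat
    refine ⟨r, tendsto_iff_norm_sub_tendsto_zero.2 ?_⟩
    exact squeeze_zero (fun n => norm_nonneg _) (fun n => (hr n).le)
      tendsto_one_div_add_atTop_nhds_zero_nat

theorem cuntzBelow_of_forall_approx {a b : D}
    (h : ∀ ε : ℝ, 0 < ε → ∃ a' : D, ‖a' - a‖ < ε ∧ CuntzBelow a' b) : CuntzBelow a b := by
  rw [cuntzBelow_iff_forall_exists_norm_lt]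
  intro ε hε
  obtain ⟨a', ha', hb⟩ := h (ε / 2) (half_pos hε)
  obtain ⟨r, hr⟩ := cuntzBelow_iff_forall_exists_norm_lt.1 hb (ε / 2) (half_pos hε)
  refine ⟨r, ?_⟩
  calc ‖r * b * star r - a‖ = ‖(r * b * star r - a') + (a' - a)‖ := by rw [sub_add_sub_cancel]
    _ ≤ _ := norm_add_le _ _
    _ < ε := by linarith

/-- The elements `d i` are approximately realized by pairwise orthogonal copies inside the
hereditary subalgebra generated by `c`. -/
def OrthogonallyBelow {ι : Type*} [DecidableEq ι] (d : ι → D) (c : D) : Prop :=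
  ∀ ε : ℝ, 0 < ε → ∃ r : ι → D,
    ∀ i l, ‖r i * c * star (r l) - if i = l then d i else 0‖ < ε

theorem OrthogonallyBelow.cuntzBelow_sum {ι : Type*} [Fintype ι] [DecidableEq ι] {d : ι → D}
    {c : D} (h : OrthogonallyBelow d c) (y : ι → D) :
    CuntzBelow (∑ i, y i * d i * star (y i)) c := by
  choose r hr using fun n : ℕ => h (1 / ((n : ℝ) + 1)) Nat.one_div_pos_of_nat
  have hlim : ∀ i l, Tendsto (fun n => r n i * c * star (r n l)) atTop
      (𝓝 (if i = l then d i else 0)) := fun i l =>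
    tendsto_iff_norm_sub_tendsto_zero.2 <| squeeze_zero (fun n => norm_nonneg _)
      (fun n => (hr n i l).le) tendsto_one_div_add_atTop_nhds_zero_nat
  refine ⟨fun n => ∑ i, y i * r n i, ?_⟩
  have h1 : ∀ n, (∑ i, y i * r n i) * c * star (∑ i, y i * r n i) =
      ∑ i, ∑ l, y i * (r n i * c * star (r n l)) * star (y l) := fun n => by
    simp only [star_sum, Finset.sum_mul, Finset.mul_sum, star_mul, mul_assoc]
    exact Finset.sum_comm
  have h2 : ∑ i, y i * d i * star (y i) =
      ∑ i, ∑ l, y i * (if i = l then d i else 0) * star (y l) := by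
    refine Finset.sum_congr rfl fun i _ => ?_
    simp [mul_ite, ite_mul]
  simp only [h1, h2]
  exact tendsto_finsetSum _ fun i _ => tendsto_finsetSum _ fun l _ =>
    ((hlim i l).const_mul _).mul_const _

theorem CStarNonneg.isSelfAdjoint {a : D} (ha : CStarNonneg a) : IsSelfAdjoint a := by
  obtain ⟨b, rfl⟩ := ha
  exact .star_mul_self b

theorem CStarNonneg.zero : CStarNonneg (0 : D) := ⟨0, by simp⟩

theorem CStarNonneg.conj {a : D} (ha : CStarNonneg a) (s : D) :
    CStarNonneg (s * a * star s) := by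
  obtain ⟨b, rfl⟩ := ha
  exact ⟨b * star s, by simp [mul_assoc]⟩

theorem CStarNonneg.map {E : Type*} [NonUnitalCStarAlgebra E] {a : D} (ha : CStarNonneg a)
    (φ : D →⋆ₙₐ[ℂ] E) : CStarNonneg (φ a) := by
  obtain ⟨b, rfl⟩ := ha
  exact ⟨φ b, by rw [map_mul, map_star]⟩

theorem CStarNonneg.sum {ι : Type*} (s : Finset ι) {d : ι → D} (hd : ∀ i, CStarNonneg (d i)) :
    CStarNonneg (∑ i ∈ s, d i) := by
  let := CStarAlgebra.spectralOrder D
  have := CStarAlgebra.spectralOrderedRing D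
  simp only [cStarNonneg_iff_nonneg] at hd ⊢
  exact Finset.sum_nonneg fun i _ => hd i

theorem CStarNonneg.cutdown (a : D) (η : ℝ) :
    CStarNonneg (cfcₙ (fun t : ℝ => max (t - η) 0) a) := by
  let := CStarAlgebra.spectralOrder D
  have := CStarAlgebra.spectralOrderedRing D
  rw [cStarNonneg_iff_nonneg]
  exact cfcₙ_nonneg fun t _ => le_max_right _ _

theorem CStarNonneg.norm_sub_cutdown_le {a : D} (ha : CStarNonneg a) {η : ℝ} (hη : 0 ≤ η) :
    ‖a - cfcₙ (fun t : ℝ => max (t - η) 0) a‖ ≤ η := by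
  let := CStarAlgebra.spectralOrder D
  have := CStarAlgebra.spectralOrderedRing D
  exact _root_.norm_sub_cutdown_le (cStarNonneg_iff_nonneg.1 ha) hη

theorem cuntzBelow_cutdown {a b : D} (ha : CStarNonneg a) (hb : CStarNonneg b) {η : ℝ}
    (hab : ‖a - b‖ < η) : CuntzBelow (cfcₙ (fun t : ℝ => max (t - η) 0) a) b := by
  let := CStarAlgebra.spectralOrder D
  have := CStarAlgebra.spectralOrderedRing D
  rw [cuntzBelow_iff_forall_exists_norm_lt]
  intro ε hε
  obtain ⟨s, hs⟩ := exists_conj_approx_cutdown (cStarNonneg_iff_nonneg.1 ha)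
    (cStarNonneg_iff_nonneg.1 hb) (norm_nonneg _) hab le_rfl (half_pos hε)
  exact ⟨s, by rw [norm_sub_rev]; linarith⟩

end Cuntz

/-! ### Norm estimates and the Cuntz semigroup -/

namespace IsCuntzSemigroupOf

universe u v

variable {A : Type u} [NonUnitalCStarAlgebra A] {S : Type v} [CuSemigroup S]

theorem exists_add_le_approx (h : IsCuntzSemigroupOf A S) {a b c : h.stab} (ha : CStarNonneg a)
    (hb : CStarNonneg b) (hc : CStarNonneg c) (habc : h.cls a + h.cls b ≤ h.cls c)
    {ε : ℝ} (hε : 0 < ε) :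
    ∃ r s : h.stab, ‖r * c * star r - a‖ < ε ∧ ‖s * c * star s - b‖ < ε ∧
      ‖r * c * star s‖ < ε ∧ ‖s * c * star r‖ < ε := by
  obtain ⟨a', b', ha', hb', hab', haa', hbb'⟩ := h.exists_orth a b ha hb
  have hba' : b' * a' = 0 := by
    have := congrArg star hab'
    rwa [star_mul, ha'.isSelfAdjoint.star_eq, hb'.isSelfAdjoint.star_eq, star_zero] at this
  have hsum : CStarNonneg (a' + b') := by
    simpa using CStarNonneg.sum (Finset.univ : Finset (Fin 2)) (d := ![a', b'])
      (by simp [Fin.forall_fin_two, ha', hb'])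
  obtain ⟨x, hx⟩ : CuntzBelow (a' + b') c := by
    rw [← h.cls_le_iff _ _ hsum hc, h.cls_add_orth _ _ ha' hb' hab', haa', hbb']
    exact habc
  -- a conjugating element that annihilates the orthogonal summand
  have cut : ∀ {p q : h.stab}, CStarNonneg p → CStarNonneg q → h.cls q = h.cls p →
      ∃ y : h.stab, ‖(y * q) * q * star (y * q) - p‖ < ε := by
    intro p q hp hq hpq
    obtain ⟨y, hy⟩ := cuntzBelow_iff_forall_exists_norm_lt.1
      ((h.cls_le_iff p q hp hq).1 hpq.ge) (ε / 2) (half_pos hε)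
    obtain ⟨k, hk⟩ := exists_mul_self_approx hq.isSelfAdjoint
      (ε := ε / (2 * (‖y‖ * ‖y‖ + 1))) (by positivity)
    refine ⟨y * k, ?_⟩
    have : y * k * q * q * star (y * k * q) - p =
        y * (k * q * q * star (k * q) - q) * star y + (y * q * star y - p) := by
      simp only [star_mul, mul_sub, sub_mul, mul_assoc]
      abel
    rw [this]
    refine (norm_add_le _ _).trans_lt ?_
    have h1 : ‖y * (k * q * q * star (k * q) - q) * star y‖ ≤ ε / 2 := by
      calc _ ≤ ‖y‖ * (ε / (2 * (‖y‖ * ‖y‖ + 1))) * ‖y‖ := by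
            refine (norm_mul_le _ _).trans ?_
            rw [norm_star]
            gcongr
            refine (norm_mul_le _ _).trans ?_
            gcongr
        _ = ε / 2 * ((‖y‖ * ‖y‖) / (‖y‖ * ‖y‖ + 1)) := by
            field_simp
        _ ≤ ε / 2 * 1 := by
            gcongr
            rw [div_le_one (by positivity)]
            linarith
        _ = ε / 2 := mul_one _
    linarith
  obtain ⟨y, hy⟩ := cut ha ha' haa'
  obtain ⟨z, hz⟩ := cut hb hb' hbb'
  have key : ∀ p q : h.stab, Tendsto (fun n => p * x n * c * star (q * x n)) atTop
      (𝓝 (p * (a' + b') * star q)) := fun p q => by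
    have := (hx.const_mul p).mul_const (star q)
    simpa only [star_mul, mul_assoc] using this
  have e1 : y * a' * (a' + b') * star (y * a') = y * a' * a' * star (y * a') := by
    rw [mul_add, mul_assoc y a' b', hab', mul_zero, add_zero]
  have e2 : z * b' * (a' + b') * star (z * b') = z * b' * b' * star (z * b') := by
    rw [mul_add, mul_assoc z b' a', hba', mul_zero, zero_add]
  have e3 : y * a' * (a' + b') * star (z * b') = 0 := by
    rw [mul_add, mul_assoc y a' b', hab', mul_zero, add_zero, star_mul,
      hb'.isSelfAdjoint.star_eq, ← mul_assoc, mul_assoc (y * a') a' b', hab', mul_zero, zero_mul]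
  have e4 : z * b' * (a' + b') * star (y * a') = 0 := by
    rw [mul_add, mul_assoc z b' a', hba', mul_zero, zero_add, star_mul,
      ha'.isSelfAdjoint.star_eq, ← mul_assoc, mul_assoc (z * b') b' a', hba', mul_zero, zero_mul]
  have t1 := ((key (y * a') (y * a')).sub_const a).norm
  have t2 := ((key (z * b') (z * b')).sub_const b).norm
  have t3 := (key (y * a') (z * b')).norm
  have t4 := (key (z * b') (y * a')).norm
  rw [e1] at t1
  rw [e2] at t2
  rw [e3, norm_zero] at t3
  rw [e4, norm_zero] at t4
  obtain ⟨n, h1, h2, h3, h4⟩ := ((t1.eventually_lt_const hy).and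
    ((t2.eventually_lt_const hz).and
      ((t3.eventually_lt_const hε).and (t4.eventually_lt_const hε)))).exists
  exact ⟨y * a' * x n, z * b' * x n, h1, h2, h3, h4⟩

private theorem exists_finset_orthogonal_approx (h : IsCuntzSemigroupOf A S) {ι : Type*}
    [DecidableEq ι] (s : Finset ι) {d : ι → h.stab} (hd : ∀ i, CStarNonneg (d i)) :
    ∀ {c : h.stab}, CStarNonneg c → ∑ i ∈ s, h.cls (d i) ≤ h.cls c → ∀ {ε : ℝ}, 0 < ε →
      ∃ r : ι → h.stab, ∀ i ∈ s, ∀ l ∈ s,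
        ‖r i * c * star (r l) - if i = l then d i else 0‖ < ε := by
  induction s using Finset.induction_on with
  | empty => intro c _ _ ε _; exact ⟨0, by simp⟩
  | insert a s has ih =>
    intro c hc hle ε hε
    obtain ⟨w, hw, hws⟩ := h.cls_surj (∑ i ∈ s, h.cls (d i))
    obtain ⟨ρ, hρ⟩ := ih hw hws.ge hε
    rw [Finset.sum_insert has, ← hws] at hle
    choose p q hpp hqq hpq hqp using fun n : ℕ =>
      h.exists_add_le_approx (hd a) hw hc hle (ε := 1 / ((n : ℝ) + 1)) Nat.one_div_pos_of_nat
    have lim0 : ∀ {f : ℕ → h.stab} {z : h.stab}, (∀ n, ‖f n - z‖ < 1 / ((n : ℝ) + 1)) →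
        Tendsto f atTop (𝓝 z) := fun hf =>
      tendsto_iff_norm_sub_tendsto_zero.2 <| squeeze_zero (fun n => norm_nonneg _)
        (fun n => (hf n).le) tendsto_one_div_add_atTop_nhds_zero_nat
    have Lpp := lim0 hpp
    have Lqq := lim0 hqq
    have Lpq := lim0 (z := 0) (fun n => by simpa using hpq n)
    have Lqp := lim0 (z := 0) (fun n => by simpa using hqp n)
    set R : ℕ → ι → h.stab := fun n i => if i = a then p n else ρ i * q n with hR
    have hev : ∀ i ∈ insert a s, ∀ l ∈ insert a s, ∀ᶠ n in atTop,
        ‖R n i * c * star (R n l) - if i = l then d i else 0‖ < ε := by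
      intro i hi l hl
      by_cases hia : i = a
      · subst hia
        by_cases hla : l = i
        · subst hla
          have := (Lpp.sub_const (d l)).norm
          rw [sub_self, norm_zero] at this
          simpa [hR] using this.eventually_lt_const hε
        · have := (Lpq.mul_const (star (ρ l))).norm
          rw [zero_mul, norm_zero] at this
          simpa [hR, hla, Ne.symm hla, mul_assoc] using this.eventually_lt_const hε
      · have his : i ∈ s := Finset.mem_of_mem_insert_of_ne hi hia
        by_cases hla : l = a
        · subst hla
          have := (Lqp.const_mul (ρ i)).norm
          rw [mul_zero, norm_zero] at this
          simpa [hR, hia, mul_assoc] using this.eventually_lt_const hε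
        · have hls : l ∈ s := Finset.mem_of_mem_insert_of_ne hl hla
          have := (((Lqq.const_mul (ρ i)).mul_const (star (ρ l))).sub_const
            (if i = l then d i else 0)).norm
          simpa [hR, hia, hla, mul_assoc] using
            this.eventually_lt_const (by simpa using hρ i his l hls)
    have hall : ∀ᶠ n in atTop, ∀ i ∈ insert a s, ∀ l ∈ insert a s,
        ‖R n i * c * star (R n l) - if i = l then d i else 0‖ < ε := by
      rw [Filter.eventually_all_finset]
      intro i hi
      rw [Filter.eventually_all_finset]
      exact hev i hi
    obtain ⟨n, hn⟩ := hall.exists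
    exact ⟨R n, hn⟩

theorem orthogonallyBelow_of_sum_le (h : IsCuntzSemigroupOf A S) {ι : Type*} [Fintype ι]
    [DecidableEq ι] {d : ι → h.stab} (hd : ∀ i, CStarNonneg (d i)) {c : h.stab}
    (hc : CStarNonneg c) (hle : ∑ i, h.cls (d i) ≤ h.cls c) : OrthogonallyBelow d c := by
  intro ε hε
  obtain ⟨r, hr⟩ := h.exists_finset_orthogonal_approx Finset.univ hd hc hle hε
  exact ⟨r, fun i l => hr i (Finset.mem_univ _) l (Finset.mem_univ _)⟩

private theorem exists_finset_sum_approx (h : IsCuntzSemigroupOf A S) {ι : Type*}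
    [DecidableEq ι] (s : Finset ι) {d : ι → h.stab} (hd : ∀ i, CStarNonneg (d i)) :
    ∀ {a : h.stab}, CStarNonneg a → h.cls a ≤ ∑ i ∈ s, h.cls (d i) → ∀ {ε : ℝ}, 0 < ε →
      ∃ y : ι → h.stab, ‖a - ∑ i ∈ s, y i * d i * star (y i)‖ < ε := by
  induction s using Finset.induction_on with
  | empty =>
    intro a ha hle ε hε
    rw [Finset.sum_empty, ← h.cls_zero, h.cls_le_iff _ _ ha .zero,
      cuntzBelow_iff_forall_exists_norm_lt] at hle
    obtain ⟨r, hr⟩ := hle ε hε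
    exact ⟨0, by simpa using hr⟩
  | insert b s hbs ih =>
    intro a ha hle ε hε
    obtain ⟨w, hw, hws⟩ := h.cls_surj (∑ i ∈ s, h.cls (d i))
    obtain ⟨p, q, hp, hq, hpq, hpd, hqw⟩ := h.exists_orth (d b) w (hd b) hw
    have hsum : CStarNonneg (p + q) := by
      simpa using CStarNonneg.sum (Finset.univ : Finset (Fin 2)) (d := ![p, q])
        (by simp [Fin.forall_fin_two, hp, hq])
    rw [Finset.sum_insert hbs, ← hws, ← hpd, ← hqw, ← h.cls_add_orth p q hp hq hpq,
      h.cls_le_iff _ _ ha hsum, cuntzBelow_iff_forall_exists_norm_lt] at hle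
    obtain ⟨x, hx⟩ := hle (ε / 2) (half_pos hε)
    have hδ : 0 < ε / (4 * (‖x‖ * ‖x‖ + 1)) := by positivity
    obtain ⟨u, hu⟩ := cuntzBelow_iff_forall_exists_norm_lt.1
      ((h.cls_le_iff _ _ hp (hd b)).1 hpd.le) _ hδ
    obtain ⟨y, hy⟩ := ih hq (hqw.trans hws).le hδ
    refine ⟨fun i => if i = b then x * u else x * y i, ?_⟩
    have e1 : ∑ i ∈ s, (if i = b then x * u else x * y i) * d i *
        star (if i = b then x * u else x * y i) =
        x * (∑ i ∈ s, y i * d i * star (y i)) * star x := by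
      rw [Finset.mul_sum, Finset.sum_mul]
      refine Finset.sum_congr rfl fun i hi => ?_
      rw [if_neg (by rintro rfl; exact hbs hi), star_mul]
      simp only [mul_assoc]
    rw [Finset.sum_insert hbs, e1]
    simp only [↓reduceIte]
    have e2 : a - (x * u * d b * star (x * u) +
        x * (∑ i ∈ s, y i * d i * star (y i)) * star x) =
        (a - x * (p + q) * star x) +
          (x * ((q - ∑ i ∈ s, y i * d i * star (y i)) - (u * d b * star u - p)) * star x) := by
      simp only [star_mul, mul_sub, sub_mul, mul_add, add_mul, mul_assoc]
      abel
    rw [e2]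
    refine (norm_add_le _ _).trans_lt ?_
    have h1 : ‖x * ((q - ∑ i ∈ s, y i * d i * star (y i)) - (u * d b * star u - p)) * star x‖ ≤
        ε / 2 := by
      calc _ ≤ ‖x‖ * (ε / (4 * (‖x‖ * ‖x‖ + 1)) + ε / (4 * (‖x‖ * ‖x‖ + 1))) * ‖x‖ := by
            refine (norm_mul_le _ _).trans ?_
            rw [norm_star]
            gcongr
            refine (norm_mul_le _ _).trans ?_
            gcongr
            exact (norm_sub_le _ _).trans (add_le_add hy.le hu.le)
        _ = ε / 2 * ((‖x‖ * ‖x‖) / (‖x‖ * ‖x‖ + 1)) := by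
            field_simp
            ring
        _ ≤ ε / 2 * 1 := by
            gcongr
            rw [div_le_one (by positivity)]
            linarith
        _ = ε / 2 := mul_one _
    rw [norm_sub_rev] at hx
    linarith

theorem exists_sum_approx_of_le (h : IsCuntzSemigroupOf A S) {ι : Type*} [Fintype ι]
    {d : ι → h.stab} (hd : ∀ i, CStarNonneg (d i)) {a : h.stab} (ha : CStarNonneg a)
    (hle : h.cls a ≤ ∑ i, h.cls (d i)) {ε : ℝ} (hε : 0 < ε) :
    ∃ y : ι → h.stab, ‖a - ∑ i, y i * d i * star (y i)‖ < ε := by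
  classical exact h.exists_finset_sum_approx Finset.univ hd ha hle hε

theorem cls_le_sum_of_approx (h : IsCuntzSemigroupOf A S) {ι : Type*} [Fintype ι]
    {d : ι → h.stab} (hd : ∀ i, CStarNonneg (d i)) {a : h.stab} (ha : CStarNonneg a)
    (happrox : ∀ ε : ℝ, 0 < ε → ∃ y : ι → h.stab, ‖a - ∑ i, y i * d i * star (y i)‖ < ε) :
    h.cls a ≤ ∑ i, h.cls (d i) := by
  classical
  obtain ⟨w, hw, hws⟩ := h.cls_surj (∑ i, h.cls (d i))
  rw [← hws, h.cls_le_iff _ _ ha hw]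
  refine cuntzBelow_of_forall_approx fun ε hε => ?_
  obtain ⟨y, hy⟩ := happrox ε hε
  exact ⟨_, by rwa [norm_sub_rev], (h.orthogonallyBelow_of_sum_le hd hw hws.ge).cuntzBelow_sum y⟩

theorem sum_cls_le_of_orthogonallyBelow (h : IsCuntzSemigroupOf A S) {ι : Type*} [Fintype ι]
    [DecidableEq ι] {d : ι → h.stab} (hd : ∀ i, CStarNonneg (d i)) {c : h.stab}
    (hc : CStarNonneg c) (hdc : OrthogonallyBelow d c) : ∑ i, h.cls (d i) ≤ h.cls c := by
  obtain ⟨w, hw, hws⟩ := h.cls_surj (∑ i, h.cls (d i))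
  rw [← hws, h.cls_le_iff _ _ hw hc]
  refine cuntzBelow_of_forall_approx fun ε hε => ?_
  obtain ⟨y, hy⟩ := h.exists_sum_approx_of_le hd hw hws.le hε
  exact ⟨_, by rwa [norm_sub_rev], hdc.cuntzBelow_sum y⟩

theorem cls_sum_le (h : IsCuntzSemigroupOf A S) {ι : Type*} [Fintype ι]
    {d : ι → h.stab} (hd : ∀ i, CStarNonneg (d i)) :
    h.cls (∑ i, d i) ≤ ∑ i, h.cls (d i) := by
  refine h.cls_le_sum_of_approx hd (.sum _ hd) fun ε hε => ?_
  choose k hk using fun i => exists_mul_self_approx (hd i).isSelfAdjoint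
    (ε := ε / (Fintype.card ι + 1)) (by positivity)
  refine ⟨fun i => k i * d i, ?_⟩
  rw [← Finset.sum_sub_distrib]
  calc _ ≤ ∑ i : ι, ‖d i - k i * d i * d i * star (k i * d i)‖ := norm_sum_le _ _
    _ ≤ ∑ i : ι, ε / (Fintype.card ι + 1) :=
        Finset.sum_le_sum fun i _ => by rw [norm_sub_rev]; exact hk i
    _ = ε * (Fintype.card ι / (Fintype.card ι + 1)) := by
        rw [Finset.sum_const, Finset.card_univ, nsmul_eq_mul]; ring
    _ < ε * 1 := by
        gcongr
        rw [div_lt_one (by positivity)]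
        linarith
    _ = ε := mul_one _

end IsCuntzSemigroupOf

section MatrixAlgebra

variable {D E ι : Type*} [NonUnitalCStarAlgebra D] [NonUnitalCStarAlgebra E] [Fintype ι]
  [DecidableEq ι]

/-- The corner embedding `a ↦ a ⊗ e_{pp}` as a star homomorphism. -/
noncomputable def Matrix.singleStarHom (D : Type*) [NonUnitalCStarAlgebra D] (p : ι) :
    D →⋆ₙₐ[ℂ] Matrix ι ι D where
  toFun a := Matrix.single p p a
  map_smul' z a := by simp [Matrix.smul_single]
  map_zero' := by simp
  map_add' a b := Matrix.single_add p p a b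
  map_mul' a b := by simp
  map_star' a := by simp [Matrix.star_eq_conjTranspose, Matrix.conjTranspose_single]

/-- The diagonal embedding `a ↦ a ⊗ 1` as a star homomorphism. -/
noncomputable def Matrix.diagonalStarHom (D ι : Type*) [NonUnitalCStarAlgebra D] [Fintype ι]
    [DecidableEq ι] : D →⋆ₙₐ[ℂ] Matrix ι ι D where
  toFun a := Matrix.diagonal fun _ => a
  map_smul' z a := by ext i j; by_cases h : i = j <;> simp [h, Matrix.diagonal]
  map_zero' := by simp
  map_add' a b := by ext i j; by_cases h : i = j <;> simp [h, Matrix.diagonal]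
  map_mul' a b := by simp
  map_star' a := by simp [Matrix.star_eq_conjTranspose, Matrix.diagonal_conjTranspose]

theorem norm_map_single_le (φ : Matrix ι ι D →⋆ₙₐ[ℂ] E) (p q : ι) (a : D) :
    ‖φ (Matrix.single p q a)‖ ≤ ‖a‖ := by
  have h1 : star (φ (Matrix.single p q a)) * φ (Matrix.single p q a) =
      (φ.comp (Matrix.singleStarHom D q)) (star a * a) := by
    rw [← map_star, ← map_mul, Matrix.star_eq_conjTranspose, Matrix.conjTranspose_single,
      Matrix.single_mul_single_same]
    rfl
  have h2 : ‖φ (Matrix.single p q a)‖ * ‖φ (Matrix.single p q a)‖ ≤ ‖a‖ * ‖a‖ := by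
    rw [← CStarRing.norm_star_mul_self, ← CStarRing.norm_star_mul_self, h1]
    exact NonUnitalStarAlgHom.norm_apply_le (φ.comp (Matrix.singleStarHom D q)) _
  exact (mul_self_le_mul_self_iff (norm_nonneg _) (norm_nonneg _)).2 h2

theorem norm_map_matrix_le_sum (φ : Matrix ι ι D →⋆ₙₐ[ℂ] E) (M : Matrix ι ι D) :
    ‖φ M‖ ≤ ∑ p, ∑ q, ‖M p q‖ := by
  conv_lhs => rw [Matrix.matrix_eq_sum_single M]
  simp only [map_sum]
  refine (norm_sum_le _ _).trans (Finset.sum_le_sum fun p _ => (norm_sum_le _ _).trans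
    (Finset.sum_le_sum fun q _ => norm_map_single_le φ p q _))

theorem norm_entry_le_norm_map {ι : Type*} [Fintype ι] (φ : Matrix ι ι D →⋆ₙₐ[ℂ] E)
    (hφ : Function.Injective φ) (M : Matrix ι ι D) (p q : ι) : ‖M p q‖ ≤ ‖φ M‖ := by
  let := CStarAlgebra.spectralOrder D
  have := CStarAlgebra.spectralOrderedRing D
  let ψ : CStarMatrix ι ι D →⋆ₙₐ[ℂ] E :=
    { toFun := fun M => φ (CStarMatrix.ofMatrix.symm M)
      map_smul' := fun z M => map_smul φ z (CStarMatrix.ofMatrix.symm M)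
      map_zero' := map_zero φ
      map_add' := fun M N => map_add φ (CStarMatrix.ofMatrix.symm M) (CStarMatrix.ofMatrix.symm N)
      map_mul' := fun M N => map_mul φ (CStarMatrix.ofMatrix.symm M) (CStarMatrix.ofMatrix.symm N)
      map_star' := fun M => map_star φ (CStarMatrix.ofMatrix.symm M) }
  have hψ : Function.Injective ψ := fun M N h => CStarMatrix.ofMatrix.symm.injective (hφ h)
  calc ‖M p q‖ ≤ ‖CStarMatrix.ofMatrix M‖ :=
        CStarMatrix.norm_entry_le_norm (M := CStarMatrix.ofMatrix M)
    _ = ‖ψ (CStarMatrix.ofMatrix M)‖ := (NonUnitalStarAlgHom.norm_map ψ hψ _).symm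
    _ = ‖φ M‖ := rfl

/-- An almost orthogonal family of subelements of `c` that are close to `d` yields orthogonal
copies of every cut-down of `d` below `c`. -/
theorem orthogonallyBelow_cutdown {c d : D} (hc : CStarNonneg c) (hd : CStarNonneg d) (r : ι → D)
    {η δ : ℝ} (hη : 0 ≤ η)
    (hr : ∀ i l, ‖star (r i) * c * r l - if i = l then d else 0‖ ≤ δ)
    (hδ : ∑ _i : ι, ∑ _l : ι, δ < η) :
    OrthogonallyBelow (fun _ : ι => cfcₙ (fun t : ℝ => max (t - η) 0) d) c := by
  rcases isEmpty_or_nonempty ι with hι | ⟨⟨i₀⟩⟩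
  · exact fun ε _ => ⟨r, fun i => hι.elim i⟩
  let := CStarAlgebra.spectralOrder D
  have := CStarAlgebra.spectralOrderedRing D
  let φ : Matrix ι ι D →⋆ₙₐ[ℂ] CStarMatrix ι ι D :=
    { toFun := CStarMatrix.ofMatrix
      map_smul' := fun _ _ => rfl
      map_zero' := rfl
      map_add' := fun _ _ => rfl
      map_mul' := fun _ _ => rfl
      map_star' := fun _ => rfl }
  let ψ : D →⋆ₙₐ[ℂ] CStarMatrix ι ι D := φ.comp (Matrix.diagonalStarHom D ι)
  let b : Matrix ι ι D := Matrix.of fun i l => star (r i) * c * r l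
  have hb : CStarNonneg (φ b) := by
    obtain ⟨h, rfl⟩ := hc
    refine ⟨φ (Matrix.of fun p l => if p = i₀ then h * r l else 0), ?_⟩
    rw [← map_star, ← map_mul]
    congr 1
    ext i l
    simp [b, Matrix.mul_apply, Matrix.star_apply, mul_assoc]
  have hclose : ‖ψ d - φ b‖ < η := by
    have : ψ d - φ b = φ (Matrix.diagonalStarHom D ι d - b) := (map_sub φ _ _).symm
    rw [this]
    refine (norm_map_matrix_le_sum φ _).trans_lt (lt_of_le_of_lt ?_ hδ)
    refine Finset.sum_le_sum fun i _ => Finset.sum_le_sum fun l _ => ?_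
    rw [Matrix.sub_apply, norm_sub_rev]
    exact hr i l
  have hbelow := cuntzBelow_cutdown (hd.map ψ) hb hclose
  rw [← NonUnitalStarAlgHom.map_cfcₙ ψ _ d (by fun_prop) (by simpa using hη)
    (by fun_prop)
    hd.isSelfAdjoint (hd.map ψ).isSelfAdjoint, cuntzBelow_iff_forall_exists_norm_lt] at hbelow
  intro ε hε
  obtain ⟨Z, hZ⟩ := hbelow ε hε
  refine ⟨fun p => ∑ i, Z p i * star (r i), fun p q => ?_⟩
  refine lt_of_eq_of_lt ?_ (CStarMatrix.norm_entry_le_norm (i := p) (j := q) |>.trans_lt hZ)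
  congr 1
  simp only [CStarMatrix.sub_apply, CStarMatrix.mul_apply, CStarMatrix.star_apply]
  congr 1
  simp only [star_sum, star_mul, star_star, Finset.sum_mul, Finset.mul_sum]
  refine Finset.sum_congr rfl fun l _ => Finset.sum_congr rfl fun i _ => ?_
  have hφb : φ b i l = star (r i) * c * r l := rfl
  simp only [hφb, mul_assoc]

end MatrixAlgebra

section Divisibility

variable {D : Type*} [NonUnitalCStarAlgebra D]

theorem norm_conj_lt_of_norm_lt {x s : D} {ε : ℝ} (hx : ‖x‖ < ε / (‖s‖ * ‖s‖ + 1)) :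
    ‖s * x * star s‖ < ε := by
  have hpos : 0 < ‖s‖ * ‖s‖ + 1 := by positivity
  rw [lt_div_iff₀ hpos] at hx
  have h1 : ‖s * x * star s‖ ≤ ‖s‖ * ‖x‖ * ‖s‖ := by
    refine (norm_mul_le _ _).trans ?_
    rw [norm_star]
    gcongr
    exact norm_mul_le _ _
  rcases (norm_nonneg x).eq_or_lt with h0 | h0
  · rw [← h0] at h1 hx
    linarith
  · nlinarith

/-- The norm-approximate form of weak `(k, n)`-divisibility of the Cuntz class of `c`. -/
def StablyApproxDivides (k n : ℕ) (c : D) : Prop :=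
  ∀ ε : ℝ, 0 < ε → ∃ (e : Fin n → D) (r : Fin n → Fin k → D), ‖c - ∑ j, e j‖ < ε ∧
    ∀ j i l, ‖star (r j i) * c * r j l - if i = l then e j else 0‖ < ε

namespace CuDiv

variable {S : Type*} [CuSemigroup S]

theorem IsWeaklyDivisible.mono {k n n' : ℕ} {x : S} (hx : IsWeaklyDivisible k n x)
    (hn : n ≤ n') : IsWeaklyDivisible k n' x := by
  intro x' hx'
  obtain ⟨y, hy, hyx⟩ := hx x' hx'
  obtain ⟨t, rfl⟩ := Nat.exists_eq_add_of_le hn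
  refine ⟨Fin.append y 0, by simpa [Fin.sum_univ_add] using hy, fun j => ?_⟩
  induction j using Fin.addCases with
  | left j => simpa using hyx j
  | right j => simpa using CuSemigroup.zero_le' x

theorem wdiv_le_iff {k n : ℕ} {x : S} :
    wdiv k x ≤ (n : ℕ∞) ↔ 1 ≤ n ∧ IsWeaklyDivisible k n x := by
  constructor
  · intro h
    have hne : {N : ℕ∞ | ∃ n : ℕ, 1 ≤ n ∧ N = n ∧ IsWeaklyDivisible k n x}.Nonempty := by
      by_contra hcon
      rw [Set.not_nonempty_iff_eq_empty] at hcon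
      rw [wdiv, hcon, sInf_empty] at h
      exact absurd h (by simp)
    obtain ⟨n', h1, h2, h3⟩ := csInf_mem hne
    rw [wdiv, h2, Nat.cast_le] at h
    exact ⟨h1.trans h, h3.mono h⟩
  · rintro ⟨h1, h2⟩
    exact sInf_le ⟨n, h1, rfl, h2⟩

end CuDiv

theorem IsCuntzSemigroupOf.isWeaklyDivisible_cls_iff {A S : Type*} [NonUnitalCStarAlgebra A]
    [CuSemigroup S] (h : IsCuntzSemigroupOf A S) {c : h.stab} (hc : CStarNonneg c) {k n : ℕ}
    (hk : 1 ≤ k) : CuDiv.IsWeaklyDivisible k n (h.cls c) ↔ StablyApproxDivides k n c := by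
  constructor
  · intro hdiv ε hε
    obtain ⟨y, hy, hyc⟩ := hdiv _ ((h.waybelow_iff _ c hc).2 ⟨ε / 2, half_pos hε, le_rfl⟩)
    choose d hd hdy using fun j => h.cls_surj (y j)
    obtain ⟨s, hs⟩ := h.exists_sum_approx_of_le hd (.cutdown c (ε / 2))
      (by simpa only [hdy] using hy) (half_pos hε)
    have hρ : ∀ j, ∃ ρ : Fin k → h.stab, ∀ i l,
        ‖ρ i * c * star (ρ l) - if i = l then d j else 0‖ < ε / (‖s j‖ * ‖s j‖ + 1) := fun j =>
      h.orthogonallyBelow_of_sum_le (d := fun _ : Fin k => d j) (fun _ => hd j) hc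
        (by simpa [hdy] using hyc j) _ (by positivity)
    choose ρ hρ using hρ
    refine ⟨fun j => s j * d j * star (s j), fun j i => star (ρ j i) * star (s j), ?_, ?_⟩
    · have h1 := hc.norm_sub_cutdown_le (half_pos hε).le
      calc _ = ‖(c - cfcₙ (fun t : ℝ => max (t - ε / 2) 0) c) +
            (cfcₙ (fun t : ℝ => max (t - ε / 2) 0) c - ∑ j, s j * d j * star (s j))‖ := by
            rw [sub_add_sub_cancel]
        _ < ε := (norm_add_le _ _).trans_lt (by linarith)
    · intro j i l
      have := norm_conj_lt_of_norm_lt (hρ j i l)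
      convert this using 2
      split_ifs <;> simp [mul_sub, sub_mul, mul_assoc]
  · intro hdiv x' hx'
    obtain ⟨ε, hε, hx'⟩ := (h.waybelow_iff _ c hc).1 hx'
    set η : ℝ := ε / (2 * (n + 1)) with hηdef
    have hη : 0 < η := by positivity
    set δ : ℝ := η / (4 * (k * k + 1)) with hδdef
    have hδ : 0 < δ := by positivity
    have hεη : ε = 2 * (n + 1) * η := by rw [hηdef]; field_simp
    have hηδ : η = 4 * (k * k + 1) * δ := by rw [hδdef]; field_simp
    obtain ⟨e, r, he, hr⟩ := hdiv δ hδ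
    let i₀ : Fin k := ⟨0, hk⟩
    let d : Fin n → h.stab := fun j => star (r j i₀) * c * r j i₀
    have hd : ∀ j, CStarNonneg (d j) := fun j => by
      simpa using hc.conj (star (r j i₀))
    have hed : ∀ j, ‖e j - d j‖ < δ := fun j => by
      rw [norm_sub_rev]
      simpa using hr j i₀ i₀
    have hD := fun j => CStarNonneg.cutdown (d j) η
    refine ⟨fun j => h.cls (cfcₙ (fun t : ℝ => max (t - η) 0) (d j)), ?_, fun j => ?_⟩
    · refine hx'.trans (le_trans ?_ (h.cls_sum_le hD))
      rw [h.cls_le_iff _ _ (.cutdown c ε) (.sum _ hD)]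
      refine cuntzBelow_cutdown hc (.sum _ hD) ?_
      have e1 : c - ∑ j, cfcₙ (fun t : ℝ => max (t - η) 0) (d j) = (c - ∑ j, e j) +
          ∑ j, (e j - d j) + ∑ j, (d j - cfcₙ (fun t : ℝ => max (t - η) 0) (d j)) := by
        simp only [Finset.sum_sub_distrib]
        abel
      have e2 : ‖∑ j, (e j - d j)‖ ≤ n * δ := by
        simpa using norm_sum_le_of_le Finset.univ fun j _ => (hed j).le
      have e3 : ‖∑ j, (d j - cfcₙ (fun t : ℝ => max (t - η) 0) (d j))‖ ≤ n * η := by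
        simpa using norm_sum_le_of_le Finset.univ fun j _ => (hd j).norm_sub_cutdown_le hη.le
      have e4 : δ ≤ η := by nlinarith [mul_self_nonneg (k : ℝ)]
      have e5 : (n : ℝ) * δ ≤ n * η := by gcongr
      rw [e1]
      refine ((norm_add_le _ _).trans (add_le_add_left (norm_add_le _ _) _)).trans_lt ?_
      rw [hεη]
      linarith
    · have := h.sum_cls_le_of_orthogonallyBelow (fun _ : Fin k => hD j) hc
        (orthogonallyBelow_cutdown hc (hd j) (r j) (δ := 2 * δ) hη.le (fun i l => ?_) ?_)
      · simpa using this
      · have h1 := hr j i l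
        have h2 := hed j
        split_ifs at h1 ⊢ with hil
        · rw [← sub_add_sub_cancel _ (e j)]
          exact (norm_add_le _ _).trans (by linarith)
        · linarith
      · simp only [Finset.sum_const, Finset.card_univ, Fintype.card_fin, nsmul_eq_mul]
        nlinarith

end Divisibility

section ApproxDivides

/-- The entrywise, norm-approximate form of weak divisibility for the class of the diagonal matrix
`c ⊗ 1` in the matrix algebra with index set `ι`: the set `κ` indexes the orthogonal copies and
`ν` the summands. -/
def ApproxDivides {D : Type*} [NonUnitalCStarAlgebra D] (ι κ ν : Type*) [Fintype ι] [DecidableEq ι]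
    [DecidableEq κ] [Fintype ν] (c : D) : Prop :=
  ∀ ε : ℝ, 0 < ε → ∃ (e : ν → ι → ι → D) (r : ν → κ → ι → ι → D),
    (∀ p q, ‖(if p = q then c else 0) - ∑ j, e j p q‖ < ε) ∧
    ∀ j i l p q, ‖(∑ t, star (r j i t p) * c * r j l t q) - if i = l then e j p q else 0‖ < ε

theorem ApproxDivides.reindex {D ι κ ν ι' κ' ν' : Type*} [NonUnitalCStarAlgebra D] [Fintype ι]
    [DecidableEq ι] [DecidableEq κ] [Fintype ν] [Fintype ι'] [DecidableEq ι'] [DecidableEq κ']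
    [Fintype ν'] {c : D} (h : ApproxDivides ι κ ν c) (f : ι' ≃ ι) (g : κ' ≃ κ) (k : ν' ≃ ν) :
    ApproxDivides ι' κ' ν' c := by
  intro ε hε
  obtain ⟨e, r, he, hr⟩ := h ε hε
  refine ⟨fun j p q => e (k j) (f p) (f q), fun j i p q => r (k j) (g i) (f p) (f q), ?_, ?_⟩
  · intro p q
    have := he (f p) (f q)
    rw [← k.sum_comp] at this
    simpa using this
  · intro j i l p q
    have := hr (k j) (g i) (g l) (f p) (f q)
    rw [← f.sum_comp] at this
    simpa using this

end ApproxDivides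

namespace IsCuntzSemigroupOf

variable {A S : Type*} [NonUnitalCStarAlgebra A] [CuSemigroup S]

/-- Padding a matrix by `d` extra rows and columns of zeros. -/
def padBy {A : Type*} [Zero A] {n : ℕ} (d : ℕ) (a : Matrix (Fin n) (Fin n) A) :
    Matrix (Fin (n + d)) (Fin (n + d)) A :=
  Matrix.of fun i j =>
    if h : (i : ℕ) < n ∧ (j : ℕ) < n then a ⟨i, h.1⟩ ⟨j, h.2⟩ else 0

theorem matEmb_padBy (h : IsCuntzSemigroupOf A S) {n : ℕ} (d : ℕ) (a : Matrix (Fin n) (Fin n) A) :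
    h.matEmb (n + d) (padBy d a) = h.matEmb n a := by
  induction d with
  | zero =>
    congr 1
    ext i j
    simp [padBy]
  | succ d ih =>
    rw [← ih, ← h.matEmb_compat (n + d)]
    refine congrArg (h.matEmb (n + d + 1)) ?_
    ext i j
    by_cases hij : (i : ℕ) < n ∧ (j : ℕ) < n
    · have : (i : ℕ) < n + d ∧ (j : ℕ) < n + d := by omega
      simp [padBy, matPad, hij, this]
    · simp [padBy, matPad, hij]

theorem eventually_exists_matEmb_near (h : IsCuntzSemigroupOf A S) (t : h.stab) {δ : ℝ}
    (hδ : 0 < δ) : ∀ᶠ d in atTop, ∃ M, dist (h.matEmb d M) t < δ := by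
  obtain ⟨y, hy, hyt⟩ := h.matEmb_dense.exists_dist_lt t hδ
  obtain ⟨n, M, rfl⟩ := Set.mem_iUnion.1 hy
  filter_upwards [eventually_ge_atTop n] with N hN
  obtain ⟨d, rfl⟩ := Nat.exists_eq_add_of_le hN
  exact ⟨padBy d M, by rwa [matEmb_padBy, dist_comm]⟩

theorem stablyApproxDivides_diagonal_iff (h : IsCuntzSemigroupOf A S) {m k n : ℕ} (c : A) :
    StablyApproxDivides k n (h.matEmb m (Matrix.diagonal fun _ => c)) ↔
      ApproxDivides (Fin m) (Fin k) (Fin n) c := by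
  constructor
  · intro hdiv ε hε
    obtain ⟨e, r, he, hr⟩ := hdiv ε hε
    set C := h.matEmb m (Matrix.diagonal fun _ => c) with hC
    let U : Set ((Fin n → h.stab) × (Fin n → Fin k → h.stab)) :=
      {x | ‖C - ∑ j, x.1 j‖ < ε ∧
        ∀ j i l, ‖star (x.2 j i) * C * x.2 j l - if i = l then x.1 j else 0‖ < ε}
    have hU : IsOpen U := by
      have : U = {x | ‖C - ∑ j, x.1 j‖ < ε} ∩ ⋂ j, ⋂ i, ⋂ l,
          {x | ‖star (x.2 j i) * C * x.2 j l - if i = l then x.1 j else 0‖ < ε} := by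
        ext x
        simp [U]
      rw [this]
      refine (isOpen_lt (by fun_prop) continuous_const).inter ?_
      refine isOpen_iInter_of_finite fun j => isOpen_iInter_of_finite fun i =>
        isOpen_iInter_of_finite fun l => isOpen_lt ?_ continuous_const
      split_ifs <;> fun_prop
    obtain ⟨δ, hδ, hball⟩ := Metric.isOpen_iff.1 hU (e, r) ⟨he, hr⟩
    have hev := (eventually_all.2 fun j => h.eventually_exists_matEmb_near (e j) hδ).and
      (((eventually_all.2 fun j => eventually_all.2 fun i =>
        h.eventually_exists_matEmb_near (r j i) hδ)).and (eventually_ge_atTop m))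
    obtain ⟨N, hE, hR, hN⟩ := hev.exists
    obtain ⟨d, rfl⟩ := Nat.exists_eq_add_of_le hN
    choose E hE using hE
    choose R hR using hR
    have hmem : (fun j => h.matEmb (m + d) (E j), fun j i => h.matEmb (m + d) (R j i)) ∈ U := by
      refine hball ?_
      rw [Metric.mem_ball, Prod.dist_eq, max_lt_iff, dist_pi_lt_iff hδ, dist_pi_lt_iff hδ]
      exact ⟨hE, fun j => (dist_pi_lt_iff hδ).2 fun i => hR j i⟩
    obtain ⟨hUe, hUr⟩ := hmem
    have hentry := fun M p q => norm_entry_le_norm_map (h.matEmb (m + d))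
      (h.matEmb_injective (m + d)) M p q
    rw [hC, ← h.matEmb_padBy d] at hUe hUr
    refine ⟨fun j p q => E j (p.castAdd d) (q.castAdd d),
      fun j i p q => R j i (p.castAdd d) (q.castAdd d), fun p q => ?_, fun j i l p q => ?_⟩
    · simp only at hUe
      rw [← map_sum, ← map_sub] at hUe
      refine lt_of_eq_of_lt ?_ ((hentry _ (p.castAdd d) (q.castAdd d)).trans_lt hUe)
      simp [padBy, Matrix.sum_apply, Matrix.diagonal_apply, Fin.val_inj]
    · have hj := hUr j i l
      simp only at hj
      have h0 : (if i = l then h.matEmb (m + d) (E j) else 0) =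
          h.matEmb (m + d) (if i = l then E j else 0) := by split_ifs <;> simp
      rw [h0, ← map_star, ← map_mul, ← map_mul, ← map_sub] at hj
      refine lt_of_eq_of_lt ?_ ((hentry _ (p.castAdd d) (q.castAdd d)).trans_lt hj)
      rw [mul_assoc, Matrix.sub_apply, Matrix.mul_apply, Fin.sum_univ_add]
      simp only [Matrix.mul_apply, Fin.sum_univ_add, Matrix.star_apply]
      congr 2
      · simp [padBy, Matrix.diagonal_apply, mul_assoc, Fin.val_inj]
      · split_ifs <;> rfl
  · intro hdiv ε hε
    have hδ : 0 < ε / (m * m + 1) := by positivity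
    have hsum : ∀ M : Matrix (Fin m) (Fin m) A, (∀ p q, ‖M p q‖ < ε / (m * m + 1)) →
        ‖h.matEmb m M‖ < ε := by
      intro M hM
      calc _ ≤ ∑ p, ∑ q, ‖M p q‖ := norm_map_matrix_le_sum _ _
        _ ≤ ∑ p : Fin m, ∑ q : Fin m, ε / (m * m + 1) :=
            Finset.sum_le_sum fun p _ => Finset.sum_le_sum fun q _ => (hM p q).le
        _ = ε * (m * m) / (m * m + 1) := by simp; ring
        _ < ε := by
            rw [div_lt_iff₀ (by positivity)]
            linarith
    obtain ⟨e, r, he, hr⟩ := hdiv _ hδ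
    refine ⟨fun j => h.matEmb m (Matrix.of (e j)), fun j i => h.matEmb m (Matrix.of (r j i)),
      ?_, fun j i l => ?_⟩
    · rw [← map_sum, ← map_sub]
      refine hsum _ fun p q => lt_of_eq_of_lt ?_ (he p q)
      simp [Matrix.sum_apply, Matrix.diagonal_apply]
    · have h0 : (if i = l then h.matEmb m (Matrix.of (e j)) else 0) =
          h.matEmb m (if i = l then Matrix.of (e j) else 0) := by split_ifs <;> simp
      rw [h0, ← map_star, ← map_mul, ← map_mul, ← map_sub]
      refine hsum _ fun p q => lt_of_eq_of_lt ?_ (hr j i l p q)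
      rw [mul_assoc, Matrix.sub_apply, Matrix.mul_apply]
      simp only [Matrix.diagonal_mul, Matrix.star_apply, Matrix.of_apply, mul_assoc]
      congr 2
      split_ifs <;> rfl

end IsCuntzSemigroupOf

namespace IsCuntzSemigroupOf

variable {A S : Type*} [NonUnitalCStarAlgebra A] [CuSemigroup S]

private theorem single_mul_diagonal_const {n : Type*} [Fintype n] [DecidableEq n] (o p : n)
    (u c : A) : Matrix.single o p u * (Matrix.diagonal fun _ => c) = Matrix.single o p (u * c) := by
  ext i j
  simp only [Matrix.mul_diagonal, Matrix.single_apply]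
  split_ifs <;> simp

theorem nsmul_clsA_eq (h : IsCuntzSemigroupOf A S) {m : ℕ} (hm : 1 ≤ m) {c : A}
    (hc : CStarNonneg c) :
    m • h.clsA c = h.cls (h.matEmb m (Matrix.diagonal fun _ => c)) := by
  obtain ⟨d, rfl⟩ := Nat.exists_eq_add_of_le hm
  let o : Fin (1 + d) := ⟨0, by omega⟩
  have hcls : h.clsA c = h.cls (h.matEmb (1 + d) (Matrix.single o o c)) := by
    rw [clsA, ← h.matEmb_padBy d]
    congr 2
    ext i j
    simp only [padBy, Matrix.of_apply, Matrix.single_apply, o, Fin.ext_iff, Nat.lt_one_iff,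
      dite_eq_ite]
    simp only [eq_comm]
  set G := h.matEmb (1 + d) with hG
  have hC : CStarNonneg (G (Matrix.diagonal fun _ => c)) :=
    hc.map (G.comp (Matrix.diagonalStarHom A (Fin (1 + d))))
  have hc₁ : CStarNonneg (G (Matrix.single o o c)) := hc.map (G.comp (Matrix.singleStarHom A o))
  have hu : ∀ ε : ℝ, 0 < ε → ∃ u : A, ‖u * c * star u - c‖ < ε := fun ε hε => by
    obtain ⟨k, hk⟩ := exists_mul_self_approx hc.isSelfAdjoint (half_pos hε)
    exact ⟨k * c, hk.trans_lt (by linarith)⟩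
  have hnsmul : (1 + d) • h.clsA c = ∑ _p : Fin (1 + d), h.cls (G (Matrix.single o o c)) := by
    simp [hcls]
  rw [hnsmul]
  refine le_antisymm ?_ ?_
  · refine h.sum_cls_le_of_orthogonallyBelow (fun _ => hc₁) hC fun ε hε => ?_
    obtain ⟨u, hu⟩ := hu ε hε
    refine ⟨fun p => G (Matrix.single o p u), fun p q => ?_⟩
    rw [← map_star, ← map_mul, ← map_mul, Matrix.star_eq_conjTranspose,
      Matrix.conjTranspose_single]
    split_ifs with hpq
    · subst hpq
      rw [← map_sub]
      have : Matrix.single o p u * (Matrix.diagonal fun _ => c) * Matrix.single p o (star u) -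
          Matrix.single o o c = Matrix.single o o (u * c * star u - c) := by
        rw [single_mul_diagonal_const, Matrix.single_mul_single_same]
        exact (map_sub (Matrix.singleStarHom A o) _ _).symm
      rw [this]
      exact (norm_map_single_le G _ _ _).trans_lt hu
    · have : Matrix.single o p u * (Matrix.diagonal fun _ => c) * Matrix.single q o (star u) =
          0 := by
        rw [single_mul_diagonal_const, Matrix.single_mul_single_of_ne _ _ _ _ hpq]
      rw [this]
      simpa using hε
  · refine h.cls_le_sum_of_approx (fun _ => hc₁) hC fun ε hε => ?_
    obtain ⟨u, hu⟩ := hu ε hε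
    refine ⟨fun p => G (Matrix.single p o u), ?_⟩
    have : G (Matrix.diagonal fun _ => c) - ∑ p, G (Matrix.single p o u) *
        G (Matrix.single o o c) * star (G (Matrix.single p o u)) =
        (G.comp (Matrix.diagonalStarHom A (Fin (1 + d)))) (c - u * c * star u) := by
      simp only [← map_star, ← map_mul, ← map_sum, ← map_sub, Matrix.star_eq_conjTranspose,
        Matrix.conjTranspose_single, Matrix.single_mul_single_same]
      refine congrArg G ?_
      ext i j
      simp only [Matrix.sub_apply, Matrix.sum_apply, Matrix.single_apply, Matrix.diagonal_apply,
        Matrix.diagonalStarHom]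
      by_cases hij : i = j
      · simp [hij]
      · have hne : ∀ p, ¬(p = i ∧ p = j) := fun p hp => hij (hp.1.symm.trans hp.2)
        simp [hij, hne]
    rw [this]
    refine (NonUnitalStarAlgHom.norm_apply_le
      (G.comp (Matrix.diagonalStarHom A (Fin (1 + d)))) _).trans_lt ?_
    rwa [norm_sub_rev]

theorem wdiv_nsmul_clsA_le_iff (h : IsCuntzSemigroupOf A S) {m k n : ℕ} (hm : 1 ≤ m) (hk : 1 ≤ k)
    {c : A} (hc : CStarNonneg c) : CuDiv.wdiv k (m • h.clsA c) ≤ (n : ℕ∞) ↔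
      1 ≤ n ∧ ApproxDivides (Fin m) (Fin k) (Fin n) c := by
  have hC : CStarNonneg (h.matEmb m (Matrix.diagonal fun _ => c)) :=
    hc.map ((h.matEmb m).comp (Matrix.diagonalStarHom A (Fin m)))
  rw [CuDiv.wdiv_le_iff, h.nsmul_clsA_eq hm hc, h.isWeaklyDivisible_cls_iff hC hk,
    h.stablyApproxDivides_diagonal_iff]

end IsCuntzSemigroupOf

section Combination

variable {D : Type*} [NonUnitalCStarAlgebra D]

/-- Approximate divisibility of `c` assembled from a part that is divided using columns indexed by
`ι₀` and a part that is divided using matrices over `ι₁`. -/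
theorem approxDivides_of_column_of_matrix {ι₀ ι₁ κ₀ κ₁ κ ν₀ ν₁ : Type*} [Fintype ι₀] [DecidableEq ι₀]
    [Fintype ι₁] [DecidableEq ι₁] [DecidableEq κ₀] [DecidableEq κ₁] [DecidableEq κ] [Fintype ν₀]
    [Fintype ν₁] (α : κ ≃ κ₀ × ι₁) (β : κ ≃ κ₁ × ι₀) {c : D}
    (h : ∀ ε : ℝ, 0 < ε → ∃ (E : ν₀ → D) (ρ : ν₀ → κ₀ → ι₀ → D) (F : ν₁ → ι₁ → ι₁ → D)
      (G : ν₁ → κ₁ → ι₁ → ι₁ → D),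
      (∀ p q, ‖(if p = q then c - ∑ j, E j else 0) - ∑ k, F k p q‖ < ε) ∧
      (∀ j i l, ‖(∑ p, star (ρ j i p) * c * ρ j l p) - if i = l then E j else 0‖ < ε) ∧
      ∀ k i l p q, ‖(∑ t, star (G k i t p) * c * G k l t q) - if i = l then F k p q else 0‖ < ε) :
    ApproxDivides (ι₀ × ι₁) κ (((ι₀ × ι₁) × ν₀) ⊕ (ι₀ × ν₁)) c := by
  classical
  intro ε hε
  obtain ⟨E, ρ, F, G, hEF, hρ, hG⟩ := h ε hε
  refine ⟨Sum.elim (fun a P P' => if P = a.1 ∧ P' = a.1 then E a.2 else 0)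
      (fun a P P' => if P.1 = a.1 ∧ P'.1 = a.1 then F a.2 P.2 P'.2 else 0),
    Sum.elim (fun a x P P' => if P' = a.1 ∧ P.2 = (α x).2 then ρ a.2 (α x).1 P.1 else 0)
      (fun a x P P' => if P'.1 = a.1 ∧ P.1 = (β x).2 then G a.2 (β x).1 P.2 P'.2 else 0),
    fun P P' => ?_, ?_⟩
  · rw [Fintype.sum_sum_type]
    simp only [Sum.elim_inl, Sum.elim_inr, Fintype.sum_prod_type (α₁ := ι₀ × ι₁) (α₂ := ν₀),
      Fintype.sum_prod_type (α₁ := ι₀) (α₂ := ν₁)]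
    have h1 : ∑ x : ι₀ × ι₁, ∑ j, (if P = x ∧ P' = x then E j else 0) =
        if P = P' then ∑ j, E j else 0 := by
      rw [Finset.sum_eq_single P (fun x _ hx => by simp [Ne.symm hx]) (by simp)]
      by_cases hP : P = P'
      · simp [hP]
      · simp [hP, Ne.symm hP]
    have h2 : ∑ x : ι₀, ∑ k, (if P.1 = x ∧ P'.1 = x then F k P.2 P'.2 else 0) =
        if P.1 = P'.1 then ∑ k, F k P.2 P'.2 else 0 := by
      rw [Finset.sum_eq_single P.1 (fun x _ hx => by simp [Ne.symm hx]) (by simp)]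
      by_cases hP : P.1 = P'.1
      · simp [hP]
      · simp [hP, Ne.symm hP]
    rw [h1, h2]
    by_cases hP : P.1 = P'.1
    · refine lt_of_eq_of_lt ?_ (hEF P.2 P'.2)
      simp only [hP, Prod.ext_iff, true_and, if_true]
      by_cases hP2 : P.2 = P'.2
      · simp [hP2, sub_sub]
      · simp [hP2]
    · simpa [hP, Prod.ext_iff] using hε
  · rintro (⟨a, j⟩ | ⟨a, k⟩) x y P P'
    · simp only [Sum.elim_inl]
      by_cases hP : P = a ∧ P' = a
      · obtain ⟨rfl, rfl⟩ := hP
        refine lt_of_le_of_lt ?_ (max_lt (hρ j (α x).1 (α y).1) hε)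
        simp only [Fintype.sum_prod_type, true_and]
        by_cases hxy : (α x).2 = (α y).2
        · refine le_trans (le_of_eq ?_) (le_max_left _ _)
          have : x = y ↔ (α x).1 = (α y).1 := by
            rw [← α.injective.eq_iff, Prod.ext_iff]
            simp [hxy]
          simp only [this, hxy]
          congr 2
          refine Finset.sum_congr rfl fun p _ => ?_
          rw [Finset.sum_eq_single (α y).2 (fun t _ ht => by simp [ht]) (by simp)]
          simp
        · refine le_trans (le_of_eq ?_) (le_max_right _ _)
          have hne : x ≠ y := fun e => hxy (by rw [e])
          rw [if_neg hne, sub_zero, norm_eq_zero]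
          refine Finset.sum_eq_zero fun p _ => Finset.sum_eq_zero fun t _ => ?_
          by_cases ht : t = (α x).2
          · simp [ht, hxy]
          · simp [ht]
      · have : ∑ t : ι₀ × ι₁, star (if P = a ∧ t.2 = (α x).2 then ρ j (α x).1 t.1 else 0) * c *
            (if P' = a ∧ t.2 = (α y).2 then ρ j (α y).1 t.1 else 0) = 0 := by
          refine Finset.sum_eq_zero fun t _ => ?_
          by_cases h1 : P = a
          · simp [show P' ≠ a from fun h2 => hP ⟨h1, h2⟩]
          · simp [h1]
        rw [this]
        simpa [hP] using hε
    · simp only [Sum.elim_inr]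
      by_cases hP : P.1 = a ∧ P'.1 = a
      · refine lt_of_le_of_lt ?_ (max_lt (hG k (β x).1 (β y).1 P.2 P'.2) hε)
        simp only [Fintype.sum_prod_type, hP, true_and, and_self]
        by_cases hxy : (β x).2 = (β y).2
        · refine le_trans (le_of_eq ?_) (le_max_left _ _)
          have : x = y ↔ (β x).1 = (β y).1 := by
            rw [← β.injective.eq_iff, Prod.ext_iff]
            simp [hxy]
          simp only [this, hxy]
          congr 2
          rw [Finset.sum_eq_single (β y).2 (fun t _ ht => by simp [ht]) (by simp)]
          simp
        · refine le_trans (le_of_eq ?_) (le_max_right _ _)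
          have hne : x ≠ y := fun e => hxy (by rw [e])
          rw [if_neg hne, sub_zero, norm_eq_zero]
          refine Finset.sum_eq_zero fun p _ => Finset.sum_eq_zero fun t _ => ?_
          by_cases ht : p = (β x).2
          · simp [ht, hxy]
          · simp [ht]
      · have : ∑ t : ι₀ × ι₁, star (if P.1 = a ∧ t.1 = (β x).2 then G k (β x).1 t.2 P.2 else 0) * c *
            (if P'.1 = a ∧ t.1 = (β y).2 then G k (β y).1 t.2 P'.2 else 0) = 0 := by
          refine Finset.sum_eq_zero fun t _ => ?_
          by_cases h1 : P.1 = a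
          · simp [show P'.1 ≠ a from fun h2 => hP ⟨h1, h2⟩]
          · simp [h1]
        rw [this]
        simpa [hP] using hε

end Combination

section Extension

variable {D E : Type*} [NonUnitalCStarAlgebra D] [NonUnitalCStarAlgebra E]

theorem exists_isSelfAdjoint_approx_unit {α : Type*} [Finite α] (x : α → D) {ε : ℝ} (hε : 0 < ε) :
    ∃ u : D, IsSelfAdjoint u ∧ ‖u‖ ≤ 1 ∧ ∀ i, ‖x i - u * x i‖ < ε ∧ ‖x i - x i * u‖ < ε := by
  let := CStarAlgebra.spectralOrder D
  have := CStarAlgebra.spectralOrderedRing D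
  have hl := CStarAlgebra.increasingApproximateUnit D
  have := hl.neBot
  have hev : ∀ i, ∀ᶠ u in CStarAlgebra.approximateUnit D,
      ‖x i - u * x i‖ < ε ∧ ‖x i - x i * u‖ < ε := by
    intro i
    have h1 := (hl.tendsto_mul_right (x i)).eventually (Metric.ball_mem_nhds (x i) hε)
    have h2 := (hl.tendsto_mul_left (x i)).eventually (Metric.ball_mem_nhds (x i) hε)
    filter_upwards [h1, h2] with u h1 h2
    rw [dist_comm, dist_eq_norm] at h1 h2
    exact ⟨h1, h2⟩
  obtain ⟨u, h1, h2, h3⟩ :=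
    (hl.eventually_isSelfAdjoint.and (hl.eventually_norm.and (eventually_all.2 hev))).exists
  exact ⟨u, h1, h2, h3⟩

private theorem exists_map_eq_zero_near_of_isSelfAdjoint (π : D →⋆ₙₐ[ℂ] E) {x : D}
    (hx : IsSelfAdjoint x) {ε : ℝ} (hπ : ‖π x‖ ≤ ε) : ∃ z, π z = 0 ∧ ‖x - z‖ ≤ ε := by
  have hε : 0 ≤ ε := (norm_nonneg _).trans hπ
  set f : ℝ → ℝ := fun t => max (-ε) (min t ε) with hf
  have hf0 : f 0 = 0 := by simp [hf, hε]
  have hcont : Continuous f := by fun_prop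
  refine ⟨x - cfcₙ f x, ?_, ?_⟩
  · have hπx : IsSelfAdjoint (π x) := hx.map π
    have h1 : π (cfcₙ f x) = cfcₙ f (π x) :=
      NonUnitalStarAlgHom.map_cfcₙ (R := ℝ) (S := ℂ) π f x hcont.continuousOn hf0
        (AddMonoidHomClass.continuous_of_bound π 1 fun x => by
          simpa using NonUnitalStarAlgHom.norm_apply_le π x) hx hπx
    have h2 : cfcₙ f (π x) = cfcₙ (fun t : ℝ => t) (π x) := by
      refine cfcₙ_congr fun t ht => ?_
      have h3 : |t| ≤ ε := (NonUnitalIsometricContinuousFunctionalCalculus.norm_quasispectrum_le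
        (π x) ht hπx).trans hπ
      obtain ⟨h4, h5⟩ := abs_le.1 h3
      simp [hf, h4, h5]
    rw [map_sub, h1, h2, cfcₙ_id' ℝ (π x), sub_self]
  · rw [sub_sub_cancel]
    refine norm_cfcₙ_le fun t _ => ?_
    rw [Real.norm_eq_abs, abs_le]
    exact ⟨le_max_left _ _, max_le (by linarith) (min_le_right _ _)⟩

theorem exists_map_eq_zero_near (π : D →⋆ₙₐ[ℂ] E) {x : D} {ε : ℝ} (hπ : ‖π x‖ ≤ ε) :
    ∃ z, π z = 0 ∧ ‖x - z‖ ≤ 2 * ε := by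
  obtain ⟨z₁, hz₁, hxz₁⟩ := exists_map_eq_zero_near_of_isSelfAdjoint (ε := ε) π (realPart x).2
    (by rw [map_realPart]; exact (realPart.norm_le (π x)).trans hπ)
  obtain ⟨z₂, hz₂, hxz₂⟩ := exists_map_eq_zero_near_of_isSelfAdjoint (ε := ε) π
    (imaginaryPart x).2
    (by rw [map_imaginaryPart]; exact (imaginaryPart.norm_le (π x)).trans hπ)
  refine ⟨z₁ + Complex.I • z₂, by simp [hz₁, hz₂], ?_⟩
  have h : x - (z₁ + Complex.I • z₂) =
      ((realPart x : D) - z₁) + Complex.I • ((imaginaryPart x : D) - z₂) := by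
    nth_rw 1 [← realPart_add_I_smul_imaginaryPart x]
    rw [smul_sub]
    abel
  rw [h, two_mul]
  refine (norm_add_le _ _).trans (add_le_add hxz₁ ?_)
  rwa [norm_smul, Complex.norm_I, one_mul]

/-- The compression `(1 - u) x (1 - u)`, written without reference to a unit. -/
def complCompress (u x : D) : D := x - u * x - x * u + u * x * u

theorem norm_complCompress_le {u : D} (hu : ‖u‖ ≤ 1) (x : D) : ‖complCompress u x‖ ≤ 4 * ‖x‖ := by
  have h1 : ‖u * x‖ ≤ ‖x‖ := (norm_mul_le _ _).trans (mul_le_of_le_one_left (norm_nonneg _) hu)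
  have h2 : ‖x * u‖ ≤ ‖x‖ := (norm_mul_le _ _).trans (mul_le_of_le_one_right (norm_nonneg _) hu)
  have h3 : ‖u * x * u‖ ≤ ‖x‖ :=
    ((norm_mul_le _ _).trans (mul_le_of_le_one_right (norm_nonneg _) hu)).trans h1
  have h4 := norm_add_le (x - u * x - x * u) (u * x * u)
  have h5 := norm_sub_le (x - u * x) (x * u)
  have h6 := norm_sub_le x (u * x)
  rw [complCompress]
  linarith

theorem norm_complCompress_le_of_approx {u x : D} (hu : ‖u‖ ≤ 1) :
    ‖complCompress u x‖ ≤ 2 * ‖x - u * x‖ := by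
  have h : complCompress u x = (x - u * x) - (x - u * x) * u := by
    rw [complCompress]; noncomm_ring
  have h2 : ‖(x - u * x) * u‖ ≤ ‖x - u * x‖ :=
    (norm_mul_le _ _).trans (mul_le_of_le_one_right (norm_nonneg _) hu)
  have h3 := norm_sub_le (x - u * x) ((x - u * x) * u)
  rw [h]
  linarith

theorem complCompress_sub (u x y : D) :
    complCompress u (x - y) = complCompress u x - complCompress u y := by
  simp only [complCompress]; noncomm_ring

theorem complCompress_zero (u : D) : complCompress u (0 : D) = 0 := by simp [complCompress]

theorem complCompress_sum {α : Type*} (s : Finset α) (u : D) (x : α → D) :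
    complCompress u (∑ i ∈ s, x i) = ∑ i ∈ s, complCompress u (x i) := by
  simp only [complCompress, Finset.mul_sum, Finset.sum_mul, Finset.sum_add_distrib,
    Finset.sum_sub_distrib]

theorem star_mul_mul_eq_complCompress {u : D} (hu : IsSelfAdjoint u) (c r s : D) :
    star (r - r * u) * c * (s - s * u) = complCompress u (star r * c * s) := by
  simp only [complCompress, star_sub, star_mul, hu.star_eq]; noncomm_ring

theorem exists_complCompress_small {F : Type*} [NonUnitalCStarAlgebra F] (ι : F →⋆ₙₐ[ℂ] D)
    (π : D →⋆ₙₐ[ℂ] E) (hπι : ∀ x, π x = 0 → x ∈ Set.range ι) {α : Type*} [Finite α] (x : α → D)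
    {ε : ℝ} (hx : ∀ i, ‖π (x i)‖ < ε) (hε : 0 < ε) :
    ∃ u : F, IsSelfAdjoint u ∧ ‖ι u‖ ≤ 1 ∧ ∀ i, ‖complCompress (ι u) (x i)‖ < 9 * ε := by
  choose z hz0 hz using fun i => exists_map_eq_zero_near π (hx i).le
  choose w hw using fun i => hπι (z i) (hz0 i)
  obtain ⟨u, hu, hu1, hux⟩ := exists_isSelfAdjoint_approx_unit w (half_pos hε)
  have hιu : ‖ι u‖ ≤ 1 := (NonUnitalStarAlgHom.norm_apply_le ι u).trans hu1
  refine ⟨u, hu, hιu, fun i => ?_⟩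
  have h1 : complCompress (ι u) (x i) =
      complCompress (ι u) (x i - z i) + complCompress (ι u) (z i) := by
    rw [complCompress_sub, sub_add_cancel]
  have h2 := norm_complCompress_le hιu (x i - z i)
  have h3 := norm_complCompress_le_of_approx (x := z i) hιu
  have h4 : ‖z i - ι u * z i‖ < ε / 2 := by
    rw [← hw, ← map_mul, ← map_sub]
    exact (NonUnitalStarAlgHom.norm_apply_le ι _).trans_lt (hux i).1
  have h5 := norm_add_le (complCompress (ι u) (x i - z i)) (complCompress (ι u) (z i))
  have h6 := hz i
  rw [h1]
  linarith

theorem exists_conj_complCompress_add_approx {c u : D} (hc : CStarNonneg c) (hu : IsSelfAdjoint u)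
    {δ : ℝ} (hδ : 0 < δ) :
    ∃ s : D, ‖s‖ ≤ 2 ∧ ‖c - s * (complCompress u c + u * c * u) * star s‖ ≤ δ := by
  let := CStarAlgebra.spectralOrder D
  have := CStarAlgebra.spectralOrderedRing D
  set y := complCompress u c + u * c * u with hy
  have hcy : c ≤ (2 : ℝ) • y := by
    rw [← sub_nonneg, ← cStarNonneg_iff_nonneg]
    obtain ⟨d, rfl⟩ := hc
    refine ⟨d - (d * u + d * u), ?_⟩
    simp only [hy, complCompress, star_sub, star_add, star_mul, hu.star_eq, two_smul]
    noncomm_ring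
  obtain ⟨s, hs, hsy⟩ := exists_conj_approx_of_le (cStarNonneg_iff_nonneg.1 hc) hcy hδ
  have h2 : √(2 : ℝ) * √2 = 2 := Real.mul_self_sqrt (by norm_num)
  refine ⟨(√2 : ℝ) • s, ?_, ?_⟩
  · rw [norm_smul, Real.norm_of_nonneg (Real.sqrt_nonneg _)]
    nlinarith [Real.sqrt_nonneg 2, norm_nonneg s]
  · convert hsy using 3
    rw [star_smul, star_trivial, mul_smul_comm, smul_mul_assoc, smul_mul_assoc, smul_smul, h2,
      mul_smul_comm, smul_mul_assoc]

end Extension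

section Extension

variable {A B Q : Type*} [NonUnitalCStarAlgebra A] [NonUnitalCStarAlgebra B]
  [NonUnitalCStarAlgebra Q] {ι κ ν : Type*} [Fintype ι] [DecidableEq ι] [DecidableEq κ] [Fintype ν]

theorem norm_conj_le_of_norm_le_two {s : A} (hs : ‖s‖ ≤ 2) (x : A) :
    ‖s * x * star s‖ ≤ 4 * ‖x‖ := by
  have h1 : ‖s * x * star s‖ ≤ ‖s‖ * ‖x‖ * ‖s‖ := by
    simpa using norm_mul₃_le (a := s) (b := x) (c := star s)
  nlinarith [norm_nonneg x, norm_nonneg s, mul_nonneg (norm_nonneg s) (norm_nonneg x)]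

theorem ApproxDivides.map {c : A} (h : ApproxDivides ι κ ν c) (π : A →⋆ₙₐ[ℂ] Q) :
    ApproxDivides ι κ ν (π c) := by
  intro ε hε
  obtain ⟨e, r, he, hr⟩ := h ε hε
  refine ⟨fun j p q => π (e j p q), fun j i p q => π (r j i p q), fun p q => ?_,
    fun j i l p q => ?_⟩
  · have := (NonUnitalStarAlgHom.norm_apply_le π _).trans_lt (he p q)
    rw [map_sub, map_sum, apply_ite π, map_zero] at this
    exact this
  · have := (NonUnitalStarAlgHom.norm_apply_le π _).trans_lt (hr j i l p q)
    rw [map_sub, map_sum, apply_ite π, map_zero] at this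
    simpa only [map_mul, map_star] using this

/-- Approximate divisibility descends from `A` to an ideal of `A`, given as the range of an
injective `*`-homomorphism. -/
theorem ApproxDivides.of_map_of_ideal {f : B →⋆ₙₐ[ℂ] A} (hf : Function.Injective f)
    (hl : ∀ (a : A) (b : B), a * f b ∈ Set.range f) {b : B} (h : ApproxDivides ι κ ν (f b)) :
    ApproxDivides ι κ ν b := by
  intro ε hε
  have hiso : ∀ x, ‖f x‖ = ‖x‖ := NonUnitalStarAlgHom.norm_map f hf
  obtain ⟨e, r, he, hr⟩ := h (ε / 3) (by positivity)
  obtain ⟨u, hu, hu1, hub⟩ := exists_isSelfAdjoint_approx_unit (fun _ : Unit => b)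
    (show 0 < ε / 3 by positivity)
  obtain ⟨hub1, hub2⟩ := hub ()
  have hfu : star (f u) = f u := by rw [← map_star, hu.star_eq]
  have hfu1 : ‖f u‖ ≤ 1 := (hiso u).trans_le hu1
  have hcomp : ∀ x : A, ‖f u * x * f u‖ ≤ ‖x‖ := fun x =>
    ((norm_mul_le _ _).trans (mul_le_of_le_one_right (norm_nonneg _) hfu1)).trans
      ((norm_mul_le _ _).trans (mul_le_of_le_one_left (norm_nonneg _) hfu1))
  choose g hg using fun a => hl a u
  have hg2 : ∀ x, f (u * g x) = f u * x * f u := fun x => by rw [map_mul, hg, mul_assoc]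
  refine ⟨fun j p q => u * g (e j p q), fun j i p q => g (r j i p q), fun p q => ?_,
    fun j i l p q => ?_⟩
  · have h1 : ‖(if p = q then b else 0) - u * (if p = q then b else 0) * u‖ ≤ 2 * (ε / 3) := by
      split_ifs
      · have h2 : b - u * b * u = (b - u * b) + u * (b - b * u) := by noncomm_ring
        rw [h2]
        have h3 : ‖u * (b - b * u)‖ ≤ ‖b - b * u‖ :=
          (norm_mul_le _ _).trans (mul_le_of_le_one_left (norm_nonneg _) hu1)
        have h4 := norm_add_le (b - u * b) (u * (b - b * u))
        linarith
      · simp only [mul_zero, zero_mul, sub_zero, norm_zero]; positivity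
    have h2 : ‖u * (if p = q then b else 0) * u - ∑ j, u * g (e j p q)‖ < ε / 3 := by
      have h3 := (hcomp _).trans_lt (he p q)
      rw [← hiso, map_sub, map_sum]
      simp only [hg2]
      rw [← Finset.sum_mul, ← Finset.mul_sum, map_mul, map_mul, apply_ite f, map_zero, ← sub_mul,
        ← mul_sub]
      exact h3
    have h3 := norm_sub_le_norm_sub_add_norm_sub (if p = q then b else 0)
      (u * (if p = q then b else 0) * u) (∑ j, u * g (e j p q))
    linarith
  · have h3 := (hcomp _).trans_lt (hr j i l p q)
    refine lt_of_eq_of_lt ?_ (h3.trans (by linarith))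
    rw [← hiso, map_sub, map_sum, apply_ite f, hg2, map_zero]
    simp only [map_mul, map_star, hg, star_mul, hfu, mul_sub, sub_mul, Finset.mul_sum,
      Finset.sum_mul, mul_assoc]
    congr 2
    split_ifs <;> simp

/-- Approximate divisibility for extensions: the quotient contributes columns obtained from
lifts cut down by an approximate unit of the ideal, and the ideal contributes the rest. -/
theorem ApproxDivides.extension {ι₀ ι₁ κ₀ κ₁ ν₀ ν₁ : Type*} [Fintype ι₀] [DecidableEq ι₀]
    [Nonempty ι₀] [Fintype ι₁] [DecidableEq ι₁] [Fintype κ₀] [DecidableEq κ₀] [DecidableEq κ₁]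
    [Fintype ν₀] [Fintype ν₁] (α : κ ≃ κ₀ × ι₁) (β : κ ≃ κ₁ × ι₀) {f : B →⋆ₙₐ[ℂ] A}
    (hl : ∀ (a : A) (b : B), a * f b ∈ Set.range f) {π : A →⋆ₙₐ[ℂ] Q}
    (hπ : Function.Surjective π) (hker : ∀ x, π x = 0 → x ∈ Set.range f) {c : A}
    (hc : CStarNonneg c) (hQ : ApproxDivides ι₀ κ₀ ν₀ (π c))
    (hB : ∀ b : B, CStarNonneg b → ApproxDivides ι₁ κ₁ ν₁ b) :
    ApproxDivides (ι₀ × ι₁) κ (((ι₀ × ι₁) × ν₀) ⊕ (ι₀ × ν₁)) c := by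
  refine approxDivides_of_column_of_matrix α β fun ε hε => ?_
  set δ : ℝ := ε / 50 with hδdef
  have hδ : 0 < δ := by positivity
  obtain ⟨eQ, rQ, heQ, hrQ⟩ := hQ δ hδ
  obtain ⟨o⟩ := ‹Nonempty ι₀›
  choose lift hlift using hπ
  let e : ν₀ → A := fun j => lift (eQ j o o)
  let ρ : ν₀ → κ₀ → ι₀ → A := fun j i p => lift (rQ j i p o)
  let x : Option (ν₀ × κ₀ × κ₀) → A := fun t => t.elim (c - ∑ j, e j) fun s =>
    (∑ p, star (ρ s.1 s.2.1 p) * c * ρ s.1 s.2.2 p) - if s.2.1 = s.2.2 then e s.1 else 0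
  have hx : ∀ t, ‖π (x t)‖ < δ := by
    rintro (_ | ⟨j, i, l⟩)
    · simpa [x, e, hlift] using heQ o o
    · simpa [x, e, ρ, hlift, apply_ite π, map_star] using hrQ j i l o o
  obtain ⟨u, hu, hu1, hux⟩ := exists_complCompress_small f π hker x hx hδ
  have hfu : IsSelfAdjoint (f u) := hu.map f
  obtain ⟨σ, hσ, hσc⟩ := exists_conj_complCompress_add_approx hc hfu hδ
  obtain ⟨b, hb, hbu⟩ : ∃ b : B, CStarNonneg b ∧ f b = f u * c * f u := by
    obtain ⟨d, rfl⟩ := hc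
    obtain ⟨w, hw⟩ := hl d u
    exact ⟨star w * w, ⟨w, rfl⟩, by
      rw [map_mul, map_star, hw, star_mul, hfu.star_eq]; simp only [mul_assoc]⟩
  obtain ⟨F, G, hF, hG⟩ := hB b hb δ hδ
  have hσle : ∀ y, ‖σ * y * star σ‖ ≤ 4 * ‖y‖ := norm_conj_le_of_norm_le_two hσ
  refine ⟨fun j => σ * complCompress (f u) (e j) * star σ,
    fun j i p => (ρ j i p - ρ j i p * f u) * star σ,
    fun k p q => σ * f (F k p q) * star σ, fun k i t p => f u * f (G k i t p) * star σ,
    fun p q => ?_, fun j i l => ?_, fun k i l p q => ?_⟩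
  · have h1 : ‖σ * f ((if p = q then b else 0) - ∑ k, F k p q) * star σ‖ ≤ 4 * δ := by
      refine (hσle _).trans ?_
      have := (NonUnitalStarAlgHom.norm_apply_le f _).trans_lt (hF p q)
      linarith
    have h2 : ‖σ * complCompress (f u) (c - ∑ j, e j) * star σ‖ ≤ 36 * δ := by
      refine (hσle _).trans ?_
      have := hux none
      simp only [x, Option.elim_none] at this
      linarith
    rw [map_sub, map_sum, mul_sub, sub_mul, Finset.mul_sum, Finset.sum_mul] at h1
    rw [complCompress_sub, complCompress_sum, mul_sub, sub_mul, Finset.mul_sum,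
      Finset.sum_mul] at h2
    rw [mul_add, add_mul] at hσc
    split_ifs with hpq
    · rw [if_pos hpq, hbu] at h1
      set S₁ := ∑ k, σ * f (F k p q) * star σ
      set S₂ := ∑ j, σ * complCompress (f u) (e j) * star σ
      set T₁ := σ * complCompress (f u) c * star σ
      set T₂ := σ * (f u * c * f u) * star σ
      have h3 : c - S₂ - S₁ = (c - (T₁ + T₂)) + (T₁ - S₂) + (T₂ - S₁) := by abel
      rw [h3]
      have h4 := norm_add₃_le (a := c - (T₁ + T₂)) (b := T₁ - S₂) (c := T₂ - S₁)
      linarith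
    · rw [if_neg hpq, map_zero, mul_zero, zero_mul] at h1
      linarith
  · have h1 := hux (some (j, i, l))
    simp only [x, Option.elim_some] at h1
    have h2 : (∑ p, star ((ρ j i p - ρ j i p * f u) * star σ) * c *
          ((ρ j l p - ρ j l p * f u) * star σ)) -
        (if i = l then σ * complCompress (f u) (e j) * star σ else 0) =
        σ * complCompress (f u)
          ((∑ p, star (ρ j i p) * c * ρ j l p) - if i = l then e j else 0) * star σ := by
      rw [complCompress_sub, complCompress_sum, mul_sub, sub_mul, Finset.mul_sum, Finset.sum_mul]
      congr 1
      · refine Finset.sum_congr rfl fun p _ => ?_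
        rw [← star_mul_mul_eq_complCompress hfu, star_mul, star_star]
        simp only [mul_assoc]
      · split_ifs <;> simp [complCompress_zero]
    rw [h2]
    have := hσle (complCompress (f u)
      ((∑ p, star (ρ j i p) * c * ρ j l p) - if i = l then e j else 0))
    linarith
  · have h1 := (NonUnitalStarAlgHom.norm_apply_le f _).trans_lt (hG k i l p q)
    have h2 : (∑ t, star (f u * f (G k i t p) * star σ) * c * (f u * f (G k l t q) * star σ)) -
        (if i = l then σ * f (F k p q) * star σ else 0) =
        σ * f ((∑ t, star (G k i t p) * b * G k l t q) - if i = l then F k p q else 0) *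
          star σ := by
      rw [map_sub, map_sum, mul_sub, sub_mul, Finset.mul_sum, Finset.sum_mul]
      congr 1
      · refine Finset.sum_congr rfl fun t _ => ?_
        rw [map_mul, map_mul, hbu, map_star, star_mul, star_mul, star_star, hfu.star_eq]
        simp only [mul_assoc]
      · split_ifs <;> simp
    rw [h2]
    have := hσle (f ((∑ t, star (G k i t p) * b * G k l t q) - if i = l then F k p q else 0))
    linarith

end Extension

/-- Proposition 4.5.  Bounded weak divisibility passes through
extensions: if the quotient `A/I` and the ideal `I` have uniform bounds
`wdiv_{2m₀}(m₀·[a]) ≤ n₀` and `wdiv_{2m₁}(m₁·[b]) ≤ n₁`, then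
`wdiv_{2m₀m₁}((m₀m₁)·[c]) ≤ m₀(m₁n₀ + n₁)` for every positive `c ∈ A`; conversely a
uniform bound on `A` passes to both `I` and `A/I`.  (The ideal `I` is modelled as the
range of an injective `*`-homomorphism `iota` from a C*-algebra `B`, and the quotient
`A/I` as any C*-algebra `Q` which is the image of a surjective `*`-homomorphism with
kernel `I`.) -/
theorem wdiv_bound_extension
    (A : Type) [NonUnitalCStarAlgebra A] (S : Type) [CuSemigroup S]
    (hS : IsCuntzSemigroupOf A S)
    (I : ClosedTwoSidedIdealC A)
    (B : Type) [NonUnitalCStarAlgebra B] (SB : Type) [CuSemigroup SB]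
    (hSB : IsCuntzSemigroupOf B SB)
    (iota : B →⋆ₙₐ[ℂ] A) (hinj : Function.Injective iota)
    (hrange : Set.range iota = (I.carrier : Set A))
    (Q : Type) [NonUnitalCStarAlgebra Q] (SQ : Type) [CuSemigroup SQ]
    (hSQ : IsCuntzSemigroupOf Q SQ)
    (piQ : A →⋆ₙₐ[ℂ] Q) (hsurj : Function.Surjective piQ)
    (hker : ∀ x : A, piQ x = 0 ↔ x ∈ I.carrier) :
    (∀ m₀ m₁ n₀ n₁ : ℕ, 1 ≤ m₀ → 1 ≤ m₁ →
      (∀ a : Q, CStarNonneg a → CuDiv.wdiv (2 * m₀) (m₀ • hSQ.clsA a) ≤ (n₀ : ℕ∞)) →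
      (∀ b : B, CStarNonneg b → CuDiv.wdiv (2 * m₁) (m₁ • hSB.clsA b) ≤ (n₁ : ℕ∞)) →
      ∀ c : A, CStarNonneg c →
        CuDiv.wdiv (2 * (m₀ * m₁)) ((m₀ * m₁) • hS.clsA c) ≤
          ((m₀ * (m₁ * n₀ + n₁) : ℕ) : ℕ∞)) ∧
    (∀ m n : ℕ, 1 ≤ m →
      (∀ c : A, CStarNonneg c → CuDiv.wdiv (2 * m) (m • hS.clsA c) ≤ (n : ℕ∞)) →
      (∀ a : Q, CStarNonneg a → CuDiv.wdiv (2 * m) (m • hSQ.clsA a) ≤ (n : ℕ∞)) ∧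
      (∀ b : B, CStarNonneg b → CuDiv.wdiv (2 * m) (m • hSB.clsA b) ≤ (n : ℕ∞))) := by
  have hl : ∀ (a : A) (b : B), a * iota b ∈ Set.range iota := by
    intro a b
    rw [hrange]
    exact I.mul_mem_left a _ (hrange.subset (Set.mem_range_self b))
  have hker' : ∀ x, piQ x = 0 → x ∈ Set.range iota := fun x hx => by
    rw [hrange]
    exact (hker x).1 hx
  refine ⟨fun m₀ m₁ n₀ n₁ hm₀ hm₁ hQ hB c hc => ?_,
    fun m n hm hA => ⟨fun a ha => ?_, fun b hb => ?_⟩⟩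
  · obtain ⟨hn₀, hdQ⟩ := (hSQ.wdiv_nsmul_clsA_le_iff hm₀ (by lia) (hc.map piQ)).1
      (hQ _ (hc.map piQ))
    have hdB : ∀ b : B, CStarNonneg b → ApproxDivides (Fin m₁) (Fin (2 * m₁)) (Fin n₁) b :=
      fun b hb => ((hSB.wdiv_nsmul_clsA_le_iff hm₁ (by lia) hb).1 (hB b hb)).2
    have hm : 1 ≤ m₀ * m₁ := Nat.mul_pos hm₀ hm₁
    refine (hS.wdiv_nsmul_clsA_le_iff hm (by lia) hc).2
      ⟨Nat.mul_pos hm₀ (Nat.add_pos_left (Nat.mul_pos hm₁ hn₀) _), ?_⟩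
    have : Nonempty (Fin m₀) := ⟨⟨0, hm₀⟩⟩
    have α : Fin (2 * (m₀ * m₁)) ≃ Fin (2 * m₀) × Fin m₁ :=
      Fintype.equivOfCardEq (by simp [mul_assoc])
    have β : Fin (2 * (m₀ * m₁)) ≃ Fin (2 * m₁) × Fin m₀ :=
      Fintype.equivOfCardEq (by simp only [Fintype.card_prod, Fintype.card_fin]; ring)
    exact (ApproxDivides.extension α β hl hsurj hker' hc hdQ hdB).reindex
      (Fintype.equivOfCardEq (by simp)) (Equiv.refl _)
      (Fintype.equivOfCardEq (by
        simp only [Fintype.card_sum, Fintype.card_prod, Fintype.card_fin]; ring))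
  · obtain ⟨q, rfl⟩ := ha
    obtain ⟨d, rfl⟩ := hsurj q
    have hc : CStarNonneg (star d * d) := ⟨d, rfl⟩
    obtain ⟨hn, hd⟩ := (hS.wdiv_nsmul_clsA_le_iff hm (by lia) hc).1 (hA _ hc)
    have hdQ := hd.map piQ
    rw [map_mul, map_star] at hdQ
    exact (hSQ.wdiv_nsmul_clsA_le_iff hm (by lia) ⟨_, rfl⟩).2 ⟨hn, hdQ⟩
  · obtain ⟨hn, hd⟩ := (hS.wdiv_nsmul_clsA_le_iff hm (by lia) (hb.map iota)).1
      (hA _ (hb.map iota))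
    exact (hSB.wdiv_nsmul_clsA_le_iff hm (by lia) hb).2 ⟨hn, hd.of_map_of_ideal hinj hl⟩
end

section
/- Let A be a separable C*-algebra with the Global Glimm Property such that Cu(A) is left-soft separative, let σ: Cu(A) → Cu(A)_soft be the map sending x to the largest strongly soft element dominated by x, let x ∈ Cu(A), and let m ≥ 2. Then wdiv_m(σ(x)) − 1 ≤ wdiv_m(x) ≤ wdiv_m(σ(x)) + 1. -/
/-!
Common definitions: abstract Cuntz semigroups, divisibility, and C*-algebra notions
(nowhere scatteredness, σ-unitality, etc.) used to formalize the statements.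
-/

open scoped MultiplierAlgebra ENNReal
open Filter Topology

namespace CuDiv

variable {S : Type*} [CuSemigroup S]

instance : IsOrderedAddMonoid S where
  add_le_add_left a b h c := by
    simpa only [add_comm _ c] using CuSemigroup.add_le_add' a b h c

lemma _root_.WayBelow.le {x y : S} (h : WayBelow x y) : x ≤ y := by
  obtain ⟨_, hn⟩ := h (fun _ => y) monotone_const y (by simp [Set.range_const]) le_rfl
  exact hn

lemma _root_.WayBelow.trans_le {x y z : S} (h : WayBelow x y) (hyz : y ≤ z) : WayBelow x z :=
  fun f hf s hs hz => h f hf s hs (hyz.trans hz)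

lemma _root_.LE.le.trans_wayBelow {x y z : S} (hxy : x ≤ y) (h : WayBelow y z) :
    WayBelow x z := fun f hf s hs hz => (h f hf s hs hz).imp fun _ hn => hxy.trans hn

lemma wayBelow_zero (x : S) : WayBelow 0 x :=
  fun _ _ _ _ _ => ⟨0, CuSemigroup.zero_le' _⟩

lemma exists_wayBelow_between {x z : S} (h : WayBelow x z) :
    ∃ y, WayBelow x y ∧ WayBelow y z := by
  obtain ⟨f, hf, hwb, hlub⟩ := CuSemigroup.exists_waybelow_seq z
  obtain ⟨n, hn⟩ := h f hf z hlub le_rfl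
  exact ⟨f (n + 1), hn.trans_wayBelow (hwb n),
    (hwb (n + 1)).trans_le (hlub.1 ⟨n + 2, rfl⟩)⟩

lemma le_of_forall_wayBelow {x y : S} (h : ∀ w, WayBelow w x → w ≤ y) : x ≤ y := by
  obtain ⟨f, -, hwb, hlub⟩ := CuSemigroup.exists_waybelow_seq x
  refine hlub.2 ?_
  rintro _ ⟨n, rfl⟩
  exact h _ ((hwb n).trans_le (hlub.1 ⟨n + 1, rfl⟩))

/-- Compatibility of addition with suprema of increasing sequences, in terms of `≪`. -/
def AddContinuous (S : Type*) [CuSemigroup S] : Prop :=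
  ∀ w a b : S, WayBelow w (a + b) → ∃ a' b', WayBelow a' a ∧ WayBelow b' b ∧ w ≤ a' + b'

/-- Axiom (O7): two elements below `w` have an almost upper bound below `w` and below
their sum. -/
def AlmostBounded (S : Type*) [CuSemigroup S] : Prop :=
  ∀ p' p q' q w : S, WayBelow p' p → WayBelow q' q → p ≤ w → q ≤ w →
    ∃ s, p' ≤ s ∧ q' ≤ s ∧ s ≤ w ∧ s ≤ p + q

lemma AddContinuous.isLUB_add (hS : AddContinuous S) {f g : ℕ → S} {a b : S}
    (hf : Monotone f) (hg : Monotone g) (ha : IsLUB (Set.range f) a)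
    (hb : IsLUB (Set.range g) b) : IsLUB (Set.range fun n => f n + g n) (a + b) := by
  constructor
  · rintro _ ⟨n, rfl⟩
    exact add_le_add (ha.1 ⟨n, rfl⟩) (hb.1 ⟨n, rfl⟩)
  · intro u hu
    refine le_of_forall_wayBelow fun w hw => ?_
    obtain ⟨a', b', ha', hb', hle⟩ := hS w a b hw
    obtain ⟨i, hi⟩ := ha' f hf a ha le_rfl
    obtain ⟨j, hj⟩ := hb' g hg b hb le_rfl
    calc w ≤ a' + b' := hle
      _ ≤ f (max i j) + g (max i j) :=
        add_le_add (hi.trans (hf (le_max_left _ _))) (hj.trans (hg (le_max_right _ _)))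
      _ ≤ u := hu ⟨_, rfl⟩

lemma AddContinuous.isLUB_sum (hS : AddContinuous S) {ι : Type*} (t : Finset ι)
    {f : ι → ℕ → S} {a : ι → S} (hf : ∀ i, Monotone (f i))
    (ha : ∀ i, IsLUB (Set.range (f i)) (a i)) :
    IsLUB (Set.range fun n => ∑ i ∈ t, f i n) (∑ i ∈ t, a i) := by
  classical
  induction t using Finset.induction_on with
  | empty => simp [Set.range_const]
  | insert i t hi ih =>
    simp only [Finset.sum_insert hi]
    exact hS.isLUB_add (hf i) (fun m n h => Finset.sum_le_sum fun j _ => hf j h) (ha i) ih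

lemma nsmul_le_infty (n : ℕ) (y : S) : n • y ≤ CuSemigroup.infty y :=
  (CuSemigroup.isLUB_infty y).1 ⟨n, rfl⟩

lemma le_infty (y : S) : y ≤ CuSemigroup.infty y := by simpa using nsmul_le_infty 1 y

lemma infty_le {y z : S} (h : ∀ n : ℕ, n • y ≤ z) : CuSemigroup.infty y ≤ z :=
  (CuSemigroup.isLUB_infty y).2 (by rintro _ ⟨n, rfl⟩; exact h n)

lemma infty_mono {y z : S} (h : y ≤ z) : CuSemigroup.infty y ≤ CuSemigroup.infty z :=
  infty_le fun n => (nsmul_le_nsmul_right h n).trans (nsmul_le_infty n z)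

lemma nsmul_left_monotone (y : S) : Monotone fun n : ℕ => n • y :=
  fun _ _ h => nsmul_le_nsmul_left (CuSemigroup.zero_le' y) h

lemma AddContinuous.add_le_infty (hS : AddContinuous S) {x y z : S}
    (hx : x ≤ CuSemigroup.infty z) (hy : y ≤ CuSemigroup.infty z) :
    x + y ≤ CuSemigroup.infty z := by
  refine (add_le_add hx hy).trans ((hS.isLUB_add (nsmul_left_monotone z) (nsmul_left_monotone z)
    (CuSemigroup.isLUB_infty z) (CuSemigroup.isLUB_infty z)).2 ?_)
  rintro _ ⟨n, rfl⟩
  simpa only [add_nsmul] using nsmul_le_infty (n + n) z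

lemma AddContinuous.sum_le_infty (hS : AddContinuous S) {ι : Type*} (t : Finset ι) {f : ι → S}
    {z : S} (h : ∀ i ∈ t, f i ≤ CuSemigroup.infty z) : ∑ i ∈ t, f i ≤ CuSemigroup.infty z := by
  classical
  induction t using Finset.induction_on with
  | empty => exact CuSemigroup.zero_le' _
  | insert i t hi ih =>
    rw [Finset.sum_insert hi]
    exact hS.add_le_infty (h i (by simp)) (ih fun j hj => h j (by simp [hj]))

lemma AddContinuous.infty_le_infty (hS : AddContinuous S) {y z : S}
    (h : y ≤ CuSemigroup.infty z) : CuSemigroup.infty y ≤ CuSemigroup.infty z := by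
  refine infty_le fun n => ?_
  induction n with
  | zero => simpa using CuSemigroup.zero_le' _
  | succ n ih => rw [succ_nsmul]; exact hS.add_le_infty ih h

/-- If `x' ≪ ∞y` and `y` is the supremum of `f`, then `x'` is below a multiple of a term
of `f`. -/
lemma AddContinuous.exists_le_nsmul (hS : AddContinuous S) {x' y : S}
    (h : WayBelow x' (CuSemigroup.infty y)) {f : ℕ → S} (hf : Monotone f)
    (hy : IsLUB (Set.range f) y) : ∃ k n : ℕ, x' ≤ k • f n := by
  obtain ⟨x₁, hx₁, hx₂⟩ := exists_wayBelow_between h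
  obtain ⟨k, hk⟩ := hx₂ _ (nsmul_left_monotone y) _ (CuSemigroup.isLUB_infty y) le_rfl
  have hlub := hS.isLUB_sum (Finset.range k) (fun _ => hf) (fun _ => hy)
  simp only [Finset.sum_const, Finset.card_range] at hlub
  obtain ⟨n, hn⟩ := hx₁ _ (fun i j hij => nsmul_le_nsmul_right (hf hij) k) _ hlub hk
  exact ⟨k, n, hn⟩

lemma AddContinuous.exists_wayBelow_le_nsmul (hS : AddContinuous S) {x' y : S}
    (h : WayBelow x' (CuSemigroup.infty y)) : ∃ (k : ℕ) (y' : S), WayBelow y' y ∧ x' ≤ k • y' := by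
  obtain ⟨f, hf, hwb, hlub⟩ := CuSemigroup.exists_waybelow_seq y
  obtain ⟨k, n, hkn⟩ := hS.exists_le_nsmul h hf hlub
  exact ⟨k, f n, (hwb n).trans_le (hlub.1 ⟨n + 1, rfl⟩), hkn⟩

/-! ### Strongly soft elements -/

lemma stronglySoft_zero : StronglySoft (0 : S) :=
  fun _ hx' => ⟨0, by simpa using hx'.le, CuSemigroup.zero_le' _⟩

lemma AddContinuous.stronglySoft_add_of_le_infty (hS : AddContinuous S) {s c : S}
    (hs : StronglySoft s) (hc : c ≤ CuSemigroup.infty s) : StronglySoft (s + c) := by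
  intro w hw
  obtain ⟨s', c', hs', hc', hle⟩ := hS w s c hw
  obtain ⟨t, ht, hst⟩ := hs s' hs'
  refine ⟨t, ?_, hS.add_le_infty hst (hc.trans (hS.infty_le_infty hst))⟩
  calc w + t ≤ (s' + c') + t := by gcongr
    _ = (s' + t) + c' := by abel
    _ ≤ s + c := add_le_add ht hc'.le

lemma AddContinuous.stronglySoft_nsmul (hS : AddContinuous S) {s : S} (hs : StronglySoft s)
    (n : ℕ) : StronglySoft (n • s) := by
  rcases n with _ | n
  · simpa using stronglySoft_zero (S := S)
  · rw [succ_nsmul']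
    exact hS.stronglySoft_add_of_le_infty hs (nsmul_le_infty n s)

lemma AddContinuous.exists_half (hS : AddContinuous S) (hggp : GlobalGlimm S) {p q : S}
    (h : WayBelow p q) : ∃ p₁ q₁ : S, WayBelow p₁ q₁ ∧ q₁ + q₁ ≤ q ∧
      p ≤ CuSemigroup.infty p₁ := by
  obtain ⟨p₂, hp₂, hp₂q⟩ := exists_wayBelow_between h
  obtain ⟨q₁, k, hk, hq₁⟩ := hggp 2 q p₂ hp₂q
  obtain ⟨l, p₁, hp₁, hl⟩ := hS.exists_wayBelow_le_nsmul
    (hp₂.trans_le (hk.trans (nsmul_le_infty k q₁)))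
  exact ⟨p₁, q₁, hp₁, by rwa [← two_nsmul], hl.trans (nsmul_le_infty l p₁)⟩

/-- Under the Global Glimm Property, every element approximately dominates a strongly soft
element generating the same ideal. -/
lemma AddContinuous.exists_stronglySoft_le (hS : AddContinuous S) (hggp : GlobalGlimm S)
    {a' a : S} (h : WayBelow a' a) :
    ∃ s : S, StronglySoft s ∧ s ≤ a ∧ a' ≤ CuSemigroup.infty s := by
  choose! P Q hPQ hQ hP using fun pq : S × S => fun h : WayBelow pq.1 pq.2 =>
    hS.exists_half hggp h
  let u : ℕ → S × S := fun n => (fun pq => (P pq, Q pq))^[n] (a', a)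
  have hu : ∀ n, u (n + 1) = (P (u n), Q (u n)) := fun n =>
    Function.iterate_succ_apply' _ _ _
  have hwb : ∀ n, WayBelow (u n).1 (u n).2 := by
    intro n
    induction n with
    | zero => exact h
    | succ n ih => rw [hu]; exact hPQ _ ih
  let d : ℕ → S := fun n => (u (n + 1)).1
  have hd : ∀ n, d n ≤ CuSemigroup.infty (d (n + 1)) := by
    intro n
    simp only [d]
    rw [hu (n + 1)]
    exact hP _ (hwb (n + 1))
  have hd' : ∀ i j, i ≤ j → d i ≤ CuSemigroup.infty (d j) := by
    intro i j hij
    induction j, hij using Nat.le_induction with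
    | base => exact le_infty _
    | succ j _ ih => exact ih.trans (hS.infty_le_infty (hd j))
  have hQ' : ∀ n, (u (n + 1)).2 + (u (n + 1)).2 ≤ (u n).2 := by
    intro n
    rw [hu]
    exact hQ _ (hwb n)
  have hsum : ∀ n, ∑ i ∈ Finset.range n, d i + (u n).2 ≤ a := by
    intro n
    induction n with
    | zero => simp [u]
    | succ n ih =>
      rw [Finset.sum_range_succ, add_assoc]
      refine le_trans (add_le_add le_rfl ?_) ih
      exact (add_le_add (hwb (n + 1)).le le_rfl).trans (hQ' n)
  have hmono : ∀ k, Monotone fun n => ∑ i ∈ Finset.range n, d (k + i) := fun k =>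
    monotone_nat_of_le_succ fun n => by
      rw [Finset.sum_range_succ]
      exact le_add_of_nonneg_right (CuSemigroup.zero_le' _)
  choose T hT using fun k => CuSemigroup.exists_isLUB _ (hmono k)
  have hdT : ∀ k, d k ≤ CuSemigroup.infty (T k) := fun k =>
    ((hT k).1 ⟨1, by simp⟩ : d k ≤ T k).trans (le_infty _)
  have h0 := hT 0
  simp only [zero_add] at h0
  refine ⟨T 0, fun w hw => ?_, h0.2 ?_, ?_⟩
  · obtain ⟨n, hn⟩ := hw _ (hmono 0) _ (hT 0) le_rfl
    simp only [zero_add] at hn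
    refine ⟨T n, (add_le_add hn le_rfl).trans ?_, h0.2 ?_⟩
    · refine (hS.isLUB_add (f := fun _ => ∑ i ∈ Finset.range n, d i) monotone_const (hmono n)
        (by simp [Set.range_const]) (hT n)).2 ?_
      rintro _ ⟨k, rfl⟩
      simp only [← Finset.sum_range_add]
      exact h0.1 ⟨n + k, rfl⟩
    · rintro _ ⟨k, rfl⟩
      refine hS.sum_le_infty _ fun i _ => ?_
      rcases le_total i n with hin | hin
      · exact (hd' i n hin).trans (hS.infty_le_infty (hdT n))
      · obtain ⟨j, rfl⟩ := Nat.exists_eq_add_of_le hin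
        refine le_trans ?_ (le_infty _)
        refine le_trans ?_ ((hT n).1 ⟨j + 1, rfl⟩)
        simp only [Finset.sum_range_succ]
        exact le_add_of_nonneg_left (CuSemigroup.zero_le' _)
  · rintro _ ⟨n, rfl⟩
    exact (le_add_of_nonneg_right (CuSemigroup.zero_le' _)).trans (hsum n)
  · refine le_trans (b := CuSemigroup.infty (d 0)) ?_ (hS.infty_le_infty (hdT 0))
    exact hP (a', a) h

/-- Removing from `a` a piece `s` generating its ideal leaves, approximately, a strongly soft
element. -/
lemma AddContinuous.exists_stronglySoft_add (hS : AddContinuous S) (hggp : GlobalGlimm S)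
    {p' p a s : S} (hp : WayBelow p' p) (hpa : p ≤ a) (hps : p ≤ CuSemigroup.infty s)
    (hsa : s ≤ a) : ∃ z : S, StronglySoft z ∧ z ≤ a ∧ p' ≤ z + s := by
  obtain ⟨p₁, hp₁, hp₁p⟩ := exists_wayBelow_between hp
  obtain ⟨k, s₂, hs₂, hk⟩ := hS.exists_wayBelow_le_nsmul (hp₁p.trans_le hps)
  obtain ⟨s₃, hs₂₃, hs₃⟩ := exists_wayBelow_between hs₂
  obtain ⟨s₀, hsoft, hs₀₃, hs₂₀⟩ := hS.exists_stronglySoft_le hggp hs₂₃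
  obtain ⟨c, -, hca, hac⟩ := CuSemigroup.almost_algebraic s₃ s 0 0 a hs₃ (wayBelow_zero 0)
    (by simpa using hsa)
  obtain ⟨v, w, -, hvs, hwp, hwc, hvw⟩ := CuSemigroup.almost_riesz p' p₁ s c hp₁
    (hp₁p.le.trans (hpa.trans hac))
  have hglb := CuSemigroup.isGLB_meetInfty c s₀
  have hw : w ≤ CuSemigroup.meetInfty c s₀ := by
    refine hglb.2 ?_
    rintro _ (rfl | rfl)
    · exact hwc
    · exact hwp.trans (hk.trans ((nsmul_le_infty k s₂).trans (hS.infty_le_infty hs₂₀)))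
  refine ⟨s₀ + CuSemigroup.meetInfty c s₀,
    hS.stronglySoft_add_of_le_infty hsoft (hglb.1 (by simp)),
    (add_le_add hs₀₃ (hglb.1 (by simp))).trans hca, ?_⟩
  calc p' ≤ v + w := hvw
    _ ≤ s + (s₀ + CuSemigroup.meetInfty c s₀) := add_le_add hvs
        (hw.trans (le_add_of_nonneg_left (CuSemigroup.zero_le' _)))
    _ = _ := add_comm _ _

/-! ### Elements below two given elements -/

lemma AddContinuous.exists_le_of_le_add_self (hS : AddContinuous S) (hO7 : AlmostBounded S)
    (hggp : GlobalGlimm S) {v' v t : S} (hv : WayBelow v' v) (hvt : v ≤ t + t) :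
    ∃ s : S, s ≤ v ∧ s ≤ t ∧ v' ≤ CuSemigroup.infty s := by
  obtain ⟨v₁, v₀, hv₁, hv₀, hv'⟩ := hS.exists_half hggp hv
  obtain ⟨v₂, hv₁₂, hv₂⟩ := exists_wayBelow_between hv₁
  have hv₀v : v₀ ≤ v := (le_add_of_nonneg_left (CuSemigroup.zero_le' _)).trans hv₀
  obtain ⟨p, q, hpv, hpt, hqv, hqt, hpq⟩ := CuSemigroup.almost_riesz v₂ v₀ t t hv₂
    (hv₀v.trans hvt)
  obtain ⟨p', q', hp', hq', hle⟩ := hS v₁ p q (hv₁₂.trans_le hpq)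
  obtain ⟨s, hps, hqs, hst, hs⟩ := hO7 p' p q' q t hp' hq' hpt hqt
  refine ⟨s, hs.trans ((add_le_add hpv hqv).trans hv₀), hst,
    hv'.trans (hS.infty_le_infty (hle.trans ?_))⟩
  exact hS.add_le_infty (hps.trans (le_infty s)) (hqs.trans (le_infty s))

lemma AddContinuous.exists_le_of_le_two_pow (hS : AddContinuous S) (hO7 : AlmostBounded S)
    (hggp : GlobalGlimm S) {t : S} (j : ℕ) {v' v : S} (hv : WayBelow v' v)
    (hvt : v ≤ 2 ^ j • t) : ∃ s : S, s ≤ v ∧ s ≤ t ∧ v' ≤ CuSemigroup.infty s := by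
  induction j generalizing v' v with
  | zero => exact ⟨v, le_rfl, by simpa using hvt, hv.le.trans (le_infty v)⟩
  | succ j ih =>
    rw [pow_succ, mul_nsmul, two_nsmul] at hvt
    obtain ⟨v₁, hv₁, hv₁v⟩ := exists_wayBelow_between hv
    obtain ⟨r, hrv, hrt, hr⟩ := hS.exists_le_of_le_add_self hO7 hggp hv₁v hvt
    obtain ⟨k, r', hr', hk⟩ := hS.exists_wayBelow_le_nsmul (hv₁.trans_le hr)
    obtain ⟨s, hsr, hst, hs⟩ := ih hr' hrt
    exact ⟨s, hsr.trans hrv, hst, hk.trans ((nsmul_le_infty k r').trans (hS.infty_le_infty hs))⟩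

lemma AddContinuous.exists_le_of_le_infty (hS : AddContinuous S) (hO7 : AlmostBounded S)
    (hggp : GlobalGlimm S) {v' v t : S} (hv : WayBelow v' v) (hvt : v ≤ CuSemigroup.infty t) :
    ∃ s : S, s ≤ v ∧ s ≤ t ∧ v' ≤ CuSemigroup.infty s := by
  obtain ⟨v₁, hv₁, hv₁v⟩ := exists_wayBelow_between hv
  obtain ⟨k, hk⟩ := hv₁v _ (nsmul_left_monotone t) _ (CuSemigroup.isLUB_infty t) hvt
  obtain ⟨s, hsv, hst, hs⟩ := hS.exists_le_of_le_two_pow hO7 hggp k hv₁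
    (hk.trans (nsmul_left_monotone t Nat.lt_two_pow_self.le))
  exact ⟨s, hsv.trans hv₁v.le, hst, hs⟩

/-! ### Comparison of weak divisibility numbers -/

lemma wdiv_le_wdiv_add_one {m : ℕ} {x y : S}
    (h : ∀ n, IsWeaklyDivisible m n x → IsWeaklyDivisible m (n + 1) y) :
    wdiv m y ≤ wdiv m x + 1 := by
  rcases Set.eq_empty_or_nonempty
    {N : ℕ∞ | ∃ n : ℕ, 1 ≤ n ∧ N = n ∧ IsWeaklyDivisible m n x} with he | hne
  · simp [wdiv, he]
  · obtain ⟨n, -, hn, hdiv⟩ := csInf_mem hne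
    have hx : wdiv m x = n := hn
    rw [hx]
    exact sInf_le ⟨n + 1, by omega, by push_cast; rfl, h n hdiv⟩

section Soft

variable {sigma : S → S}

lemma AddContinuous.isWeaklyDivisible_of_soft (hS : AddContinuous S) (hggp : GlobalGlimm S)
    (hsigma : ∀ x : S, StronglySoft (sigma x) ∧ sigma x ≤ x ∧
      ∀ z : S, StronglySoft z → z ≤ x → z ≤ sigma x)
    {x : S} {m n : ℕ} (hm : m ≠ 0) (h : IsWeaklyDivisible m n (sigma x)) :
    IsWeaklyDivisible m (n + 1) x := by
  intro x' hx'
  obtain ⟨x₁, hx₁, hx₁x⟩ := exists_wayBelow_between hx'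
  obtain ⟨x₂, hx₁₂, hx₂x⟩ := exists_wayBelow_between hx₁x
  obtain ⟨t, k, hk, ht⟩ := hggp m x x₂ hx₂x
  have htx : t ≤ x := by
    refine le_trans ?_ ht
    simpa using nsmul_left_monotone t (Nat.one_le_iff_ne_zero.2 hm)
  obtain ⟨z, hz, hzx, hle⟩ := hS.exists_stronglySoft_add hggp hx₁₂ hx₂x.le
    (hk.trans (nsmul_le_infty k t)) htx
  obtain ⟨s', t', hs', ht', hx's⟩ := hS x' (sigma x) t
    (hx₁.trans_le (hle.trans (add_le_add ((hsigma x).2.2 z hz hzx) le_rfl)))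
  obtain ⟨y, hy, hmy⟩ := h s' hs'
  refine ⟨Fin.snoc y t, ?_, fun j => ?_⟩
  · rw [Fin.sum_snoc]
    exact hx's.trans (add_le_add hy ht'.le)
  · refine Fin.lastCases ?_ (fun i => ?_) j
    · simpa using ht
    · simpa using (hmy i).trans (hsigma x).2.1

lemma AddContinuous.isWeaklyDivisible_soft (hS : AddContinuous S) (hO7 : AlmostBounded S)
    (hggp : GlobalGlimm S)
    (hsigma : ∀ x : S, StronglySoft (sigma x) ∧ sigma x ≤ x ∧
      ∀ z : S, StronglySoft z → z ≤ x → z ≤ sigma x)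
    {x : S} {m n : ℕ} (hm : m ≠ 0) (h : IsWeaklyDivisible m n x) :
    IsWeaklyDivisible m (n + 1) (sigma x) := by
  intro s' hs'
  have hfull : x ≤ CuSemigroup.infty (sigma x) := le_of_forall_wayBelow fun w hw => by
    obtain ⟨s, hs, hsx, hws⟩ := hS.exists_stronglySoft_le hggp hw
    exact hws.trans (infty_mono ((hsigma x).2.2 s hs hsx))
  obtain ⟨s'', hs'', hs''x⟩ := exists_wayBelow_between hs'
  obtain ⟨y, hy, hmy⟩ := h s'' (hs''x.trans_le (hsigma x).2.1)
  have hyx : ∀ j, y j ≤ x := fun j => by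
    refine le_trans ?_ (hmy j)
    simpa using nsmul_left_monotone (y j) (Nat.one_le_iff_ne_zero.2 hm)
  choose f hf hfwb hflub using fun j => CuSemigroup.exists_waybelow_seq (y j)
  obtain ⟨N, hN⟩ := hs'' _ (fun i j hij => Finset.sum_le_sum fun l _ => hf l hij) _
    (hS.isLUB_sum Finset.univ hf hflub) hy
  have hfy : ∀ j i, WayBelow (f j i) (y j) := fun j i =>
    (hfwb j i).trans_le ((hflub j).1 ⟨i + 1, rfl⟩)
  obtain ⟨g, hg, hgwb, hglub⟩ := CuSemigroup.exists_waybelow_seq (sigma x)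
  choose K I hKI using fun j => hS.exists_le_nsmul
    ((hfy j (N + 2)).trans_le ((hyx j).trans hfull)) hg hglub
  obtain ⟨t, k, hk, ht⟩ := hggp (m * n) (sigma x) (g (Finset.univ.sup I))
    ((hgwb _).trans_le (hglub.1 ⟨_, rfl⟩))
  have hft : ∀ j, f j (N + 2) ≤ CuSemigroup.infty t := fun j =>
    (hKI j).trans ((nsmul_le_nsmul_right (hg (Finset.le_sup (Finset.mem_univ j))) _).trans
      ((nsmul_le_infty _ _).trans (hS.infty_le_infty (hk.trans (nsmul_le_infty k t)))))
  choose s hsf hst hfs using fun j => hS.exists_le_of_le_infty hO7 hggp (hfwb j (N + 1)) (hft j)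
  choose z hz hzy hfz using fun j => hS.exists_stronglySoft_add hggp (hfwb j N)
    (hfy j (N + 1)).le (hfs j) ((hsf j).trans (hfy j (N + 2)).le)
  refine ⟨Fin.snoc z (∑ j, s j), ?_, fun j => ?_⟩
  · rw [Fin.sum_snoc, ← Finset.sum_add_distrib]
    exact hN.trans (Finset.sum_le_sum fun j _ => hfz j)
  · refine Fin.lastCases ?_ (fun i => ?_) j
    · simp only [Fin.snoc_last]
      refine le_trans (nsmul_le_nsmul_right (Finset.sum_le_sum fun j _ => hst j) m) ?_
      simpa [← mul_nsmul', mul_comm] using ht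
    · simp only [Fin.snoc_castSucc]
      exact (hsigma x).2.2 _ (hS.stronglySoft_nsmul (hz i) m)
        ((nsmul_le_nsmul_right (hzy i) m).trans (hmy i))

end Soft

end CuDiv

section CuntzComparison

variable {B : Type*} [NonUnitalCStarAlgebra B]

lemma cuntzBelow_of_forall {a b : B}
    (h : ∀ δ : ℝ, 0 < δ → ∃ r : B, ‖r * b * star r - a‖ ≤ δ) : CuntzBelow a b := by
  choose r hr using fun n : ℕ => h (1 / ((n : ℝ) + 1)) (by positivity)
  exact ⟨r, tendsto_iff_norm_sub_tendsto_zero.2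
    (squeeze_zero (fun _ => norm_nonneg _) hr tendsto_one_div_add_atTop_nhds_zero_nat)⟩

lemma cuntzBelow_conjugate (b r : B) : CuntzBelow (r * b * star r) b :=
  ⟨fun _ => r, tendsto_const_nhds⟩

/-- The cut-down `(a - ε)₊`. -/
noncomputable abbrev cutDown (ε : ℝ) (a : B) : B := cfcₙ (fun t : ℝ => max (t - ε) 0) a

lemma cutDown_mul_cutDown {a b : B} (ha : IsSelfAdjoint a) (hb : IsSelfAdjoint b)
    (hab : a * b = 0) {δ ε : ℝ} (hδ : 0 < δ) (hε : 0 < ε) :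
    cutDown δ a * cutDown ε b = 0 := by
  have key : ∀ {c : B} {η : ℝ}, IsSelfAdjoint c → 0 < η →
      ∃ d : B, cutDown η c = d * c ∧ cutDown η c = c * d := by
    intro c η hc hη
    have hcont : Continuous fun t : ℝ => max (t - η) 0 / max t η :=
      Continuous.div (by fun_prop) (by fun_prop) fun t => (lt_max_of_lt_right hη).ne'
    have h0 : max (0 - η) 0 / max 0 η = 0 := by simp [hη.le]
    have h : ∀ t : ℝ, max (t - η) 0 / max t η * t = max (t - η) 0 := by
      intro t
      rcases le_total t η with h | h
      · simp [h]
      · have : t ≠ 0 := (hη.trans_le h).ne'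
        rw [max_eq_left h]
        field_simp
    refine ⟨cfcₙ (fun t : ℝ => max (t - η) 0 / max t η) c, ?_, ?_⟩
    · nth_rw 3 [← cfcₙ_id' ℝ c]
      rw [← cfcₙ_mul _ _ c hcont.continuousOn h0 (by fun_prop) (by simp)]
      simp only [h]
    · nth_rw 2 [← cfcₙ_id' ℝ c]
      rw [← cfcₙ_mul _ _ c (by fun_prop) (by simp) hcont.continuousOn h0]
      simp only [mul_comm _ (max (_ - η) 0 / max _ η), h]
  obtain ⟨d, hd, -⟩ := key ha hδ
  obtain ⟨e, -, he⟩ := key hb hε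
  rw [hd, he, mul_assoc, ← mul_assoc a b e, hab, zero_mul, mul_zero]

variable [PartialOrder B] [StarOrderedRing B]

lemma cStarNonneg_iff {a : B} : CStarNonneg a ↔ 0 ≤ a :=
  CStarAlgebra.nonneg_iff_eq_star_mul_self.symm

lemma continuous_div_add_abs {f : ℝ → ℝ} (hf : Continuous f) {δ : ℝ} (hδ : 0 < δ) :
    Continuous fun t : ℝ => f t / (δ + |t|) :=
  hf.div (by fun_prop) fun t => by positivity

/-- An element dominated by a multiple of `y` is Cuntz subequivalent to `y`. -/
lemma cuntzBelow_of_le_smul {x y : B} {K : ℝ} (hx : 0 ≤ x) (hy : 0 ≤ y) (h : x ≤ K • y) :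
    CuntzBelow x y := by
  have hysa : IsSelfAdjoint y := hy.isSelfAdjoint
  obtain ⟨w, hw⟩ := CStarAlgebra.nonneg_iff_eq_star_mul_self.1 (sub_nonneg.2 h)
  set v := CFC.sqrt x
  have hvs : IsSelfAdjoint v := (CFC.sqrt_nonneg x).isSelfAdjoint
  have hv : x = star v * v := by rw [hvs.star_eq]; exact (CFC.sqrt_mul_sqrt_self x hx).symm
  let ψ : ℕ → B := fun n => cfcₙ (fun t : ℝ => t / (1 / ((n : ℝ) + 1) + |t|)) y
  let φ : ℕ → B := fun n => cfcₙ (fun t : ℝ => √|t| / (1 / ((n : ℝ) + 1) + |t|)) y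
  have hδ : ∀ n : ℕ, 0 < 1 / ((n : ℝ) + 1) := fun n => by positivity
  have hψc : ∀ n : ℕ, Continuous fun t : ℝ => t / (1 / ((n : ℝ) + 1) + |t|) := fun n =>
    continuous_div_add_abs continuous_id (hδ n)
  have hφc : ∀ n : ℕ, Continuous fun t : ℝ => √|t| / (1 / ((n : ℝ) + 1) + |t|) := fun n =>
    continuous_div_add_abs (by fun_prop) (hδ n)
  have hψ : ∀ n, IsSelfAdjoint (ψ n) := fun n => IsSelfAdjoint.cfcₙ
  have hφ : ∀ n, IsSelfAdjoint (φ n) := fun n => IsSelfAdjoint.cfcₙ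
  have hpos : ∀ t ∈ quasispectrum ℝ y, 0 ≤ t := fun t ht =>
    quasispectrum_nonneg_of_nonneg y hy t ht
  have hφψ : ∀ n, φ n * y * φ n = ψ n * ψ n := by
    intro n
    have h1 := (hφc n).continuousOn (s := quasispectrum ℝ y)
    have h2 := (hψc n).continuousOn (s := quasispectrum ℝ y)
    nth_rw 1 [← cfcₙ_id' ℝ y]
    simp only [φ, ψ]
    rw [← cfcₙ_mul _ _ y h1 (by simp) (by fun_prop) (by simp),
      ← cfcₙ_mul _ _ y (by fun_prop) (by simp) h1 (by simp),
      ← cfcₙ_mul _ _ y h2 (by simp) h2 (by simp)]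
    refine cfcₙ_congr fun t ht => ?_
    have ht' := hpos t ht
    simp only [abs_of_nonneg ht']
    have := Real.mul_self_sqrt ht'
    generalize 1 / ((n : ℝ) + 1) + t = D
    calc _ = (√t * √t) * t / (D * D) := by ring
      _ = _ := by rw [this]; ring
  have hsmall : ∀ n, ‖y - y * ψ n - ψ n * y + ψ n * y * ψ n‖ ≤ 1 / ((n : ℝ) + 1) := by
    intro n
    have h2 := (hψc n).continuousOn (s := quasispectrum ℝ y)
    have : y - y * ψ n - ψ n * y + ψ n * y * ψ n =
        cfcₙ (fun t : ℝ => t - t * (t / (1 / ((n : ℝ) + 1) + |t|))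
          - (t / (1 / ((n : ℝ) + 1) + |t|)) * t
          + (t / (1 / ((n : ℝ) + 1) + |t|)) * t * (t / (1 / ((n : ℝ) + 1) + |t|))) y := by
      rw [cfcₙ_add _ _ y (by fun_prop) (by simp) (by fun_prop) (by simp),
        cfcₙ_sub _ _ y (by fun_prop) (by simp) (by fun_prop) (by simp),
        cfcₙ_sub _ _ y (by fun_prop) (by simp) (by fun_prop) (by simp),
        cfcₙ_mul _ _ y (by fun_prop) (by simp) (by fun_prop) (by simp),
        cfcₙ_mul _ _ y (by fun_prop) (by simp) (by fun_prop) (by simp),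
        cfcₙ_mul _ _ y (by fun_prop) (by simp) (by fun_prop) (by simp),
        cfcₙ_mul _ _ y (by fun_prop) (by simp) (by fun_prop) (by simp), cfcₙ_id' ℝ y]
    rw [this]
    refine norm_cfcₙ_le fun t ht => ?_
    have ht' := hpos t ht
    have hδn := hδ n
    simp only [abs_of_nonneg ht']
    set δ := 1 / ((n : ℝ) + 1)
    have hd : 0 < δ + t := by positivity
    have heq : t - t * (t / (δ + t)) - t / (δ + t) * t + t / (δ + t) * t * (t / (δ + t)) =
        t * δ ^ 2 / (δ + t) ^ 2 := by
      field_simp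
      ring
    rw [heq, Real.norm_of_nonneg (by positivity), div_le_iff₀ (by positivity)]
    nlinarith [mul_nonneg hδn.le (sq_nonneg t), pow_pos hδn 3, mul_nonneg (sq_nonneg δ) ht']
  have hz : ∀ n, ‖v - v * ψ n‖ ^ 2 ≤ |K| * (1 / ((n : ℝ) + 1)) := by
    intro n
    have hle : star (v - v * ψ n) * (v - v * ψ n) ≤
        K • (y - y * ψ n - ψ n * y + ψ n * y * ψ n) := by
      rw [← sub_nonneg]
      convert star_mul_self_nonneg (w - w * ψ n) using 1
      have hw' : star (w - w * ψ n) * (w - w * ψ n) = (star w * w) - (star w * w) * ψ n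
          - ψ n * (star w * w) + ψ n * (star w * w) * ψ n := by
        simp only [star_sub, star_mul, (hψ n).star_eq]
        noncomm_ring
      have hv' : star (v - v * ψ n) * (v - v * ψ n) = (star v * v) - (star v * v) * ψ n
          - ψ n * (star v * v) + ψ n * (star v * v) * ψ n := by
        simp only [star_sub, star_mul, (hψ n).star_eq]
        noncomm_ring
      rw [hw', hv', ← hw, ← hv]
      simp only [sub_mul, mul_sub, smul_mul_assoc, mul_smul_comm, smul_sub, smul_add]
      abel
    calc ‖v - v * ψ n‖ ^ 2 = ‖star (v - v * ψ n) * (v - v * ψ n)‖ := by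
          rw [CStarRing.norm_star_mul_self, sq]
      _ ≤ ‖K • (y - y * ψ n - ψ n * y + ψ n * y * ψ n)‖ :=
          CStarAlgebra.norm_le_norm_of_nonneg_of_le (star_mul_self_nonneg _) hle
      _ ≤ |K| * (1 / ((n : ℝ) + 1)) := by
          rw [norm_smul, Real.norm_eq_abs]
          exact mul_le_mul_of_nonneg_left (hsmall n) (abs_nonneg K)
  have hlim : Tendsto (fun n => v * ψ n) atTop (𝓝 v) := by
    have hK : Tendsto (fun n : ℕ => √(|K| * (1 / ((n : ℝ) + 1)))) atTop (𝓝 0) := by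
      simpa using ((tendsto_one_div_add_atTop_nhds_zero_nat (𝕜 := ℝ)).const_mul |K|).sqrt
    refine tendsto_iff_norm_sub_tendsto_zero.2 (squeeze_zero (fun _ => norm_nonneg _)
      (fun n => ?_) hK)
    rw [norm_sub_rev]
    exact Real.le_sqrt_of_sq_le (hz n)
  refine ⟨fun n => v * φ n, ?_⟩
  have heq : ∀ n, v * φ n * y * star (v * φ n) = v * ψ n * star (v * ψ n) := fun n => by
    simp only [star_mul, (hφ n).star_eq, (hψ n).star_eq]
    calc v * φ n * y * (φ n * star v) = v * (φ n * y * φ n) * star v := by noncomm_ring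
      _ = _ := by rw [hφψ]; noncomm_ring
  simp only [heq]
  have hxv : x = v * star v := by rw [hv, hvs.star_eq]
  rw [hxv]
  exact hlim.mul hlim.star

lemma cuntzBelow_star_mul_self (x : B) : CuntzBelow (star x * x) (x * star x) := by
  refine cuntzBelow_of_forall fun δ hδ => ?_
  have ha : 0 ≤ star x * x := star_mul_self_nonneg x
  have hc : Continuous fun t : ℝ => √|t| / (δ / 2 + |t|) :=
    continuous_div_add_abs (by fun_prop) (half_pos hδ)
  set φ : ℝ → ℝ := fun t => √|t| / (δ / 2 + |t|)
  have hφ0 : φ 0 = 0 := by simp [φ]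
  have hφ : IsSelfAdjoint (cfcₙ φ (star x * x)) := IsSelfAdjoint.cfcₙ
  refine ⟨cfcₙ φ (star x * x) * star x, ?_⟩
  have heq : cfcₙ φ (star x * x) * star x * (x * star x) * star (cfcₙ φ (star x * x) * star x)
      - star x * x = cfcₙ (fun t => φ t * t * t * φ t - t) (star x * x) := by
    rw [cfcₙ_sub _ _ _ (by fun_prop) (by simp [hφ0]) (by fun_prop) (by simp),
      cfcₙ_mul _ _ _ (by fun_prop) (by simp) (by fun_prop) (by simp [hφ0]),
      cfcₙ_mul _ _ _ (by fun_prop) (by simp) (by fun_prop) (by simp),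
      cfcₙ_mul _ _ _ (by fun_prop) (by simp [hφ0]) (by fun_prop) (by simp),
      cfcₙ_id' ℝ (star x * x), star_mul, star_star, hφ.star_eq]
    noncomm_ring
  rw [heq]
  refine norm_cfcₙ_le fun t ht => ?_
  have ht' : 0 ≤ t := quasispectrum_nonneg_of_nonneg _ ha t ht
  have hd : 0 < δ / 2 + t := by positivity
  have h1 : φ t * t * t * φ t - t = -(t * (δ * t + δ ^ 2 / 4) / (δ / 2 + t) ^ 2) := by
    simp only [φ, abs_of_nonneg ht']
    have hs : √t ^ 2 = t := Real.sq_sqrt ht'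
    field_simp
    rw [hs]
    ring
  rw [h1, norm_neg, Real.norm_of_nonneg (by positivity), div_le_iff₀ (by positivity)]
  nlinarith [pow_pos hδ 3, mul_nonneg (sq_nonneg δ) ht', mul_nonneg hδ.le (sq_nonneg t)]

lemma cutDown_nonneg (ε : ℝ) (a : B) : 0 ≤ cutDown ε a :=
  cfcₙ_nonneg fun _ _ => le_max_right _ _

lemma norm_sub_cutDown_le {a : B} (ha : 0 ≤ a) {ε : ℝ} (hε : 0 ≤ ε) :
    ‖a - cutDown ε a‖ ≤ ε := by
  have h : a - cutDown ε a = cfcₙ (fun t : ℝ => t - max (t - ε) 0) a := by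
    rw [cfcₙ_sub _ _ _ (by fun_prop) (by simp) (by fun_prop) (by simp [hε]), cfcₙ_id' ℝ a]
  rw [h]
  refine norm_cfcₙ_le fun t ht => ?_
  have ht' : 0 ≤ t := quasispectrum_nonneg_of_nonneg _ ha t ht
  rw [Real.norm_eq_abs, abs_le]
  rcases max_cases (t - ε) 0 with h | h <;> constructor <;> linarith

lemma smul_cutDown_le_conjugate {a c : B} (ha : 0 ≤ a) (hc : IsSelfAdjoint c) {ε : ℝ}
    (hε : 0 < ε) (h : ‖a - c‖ ≤ ε) :
    ε ^ 2 • cutDown (ε + ε) a ≤ cutDown ε a * c * cutDown ε a := by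
  have hp : IsSelfAdjoint (cutDown ε a) := (cutDown_nonneg ε a).isSelfAdjoint
  have hpp : 0 ≤ cutDown ε a * cutDown ε a := by
    simpa [hp.star_eq] using star_mul_self_nonneg (cutDown ε a)
  have h1 : cutDown ε a * (a - c) * cutDown ε a ≤ ε • (cutDown ε a * cutDown ε a) := by
    have := CStarAlgebra.star_left_conjugate_le_norm_smul (a := cutDown ε a) (b := a - c)
      (ha.isSelfAdjoint.sub hc)
    rw [hp.star_eq] at this
    exact this.trans (smul_le_smul_of_nonneg_right h hpp)
  have h2 : ε ^ 2 • cutDown (ε + ε) a ≤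
      cutDown ε a * a * cutDown ε a - ε • (cutDown ε a * cutDown ε a) := by
    have heq : cutDown ε a * a * cutDown ε a - ε • (cutDown ε a * cutDown ε a) =
        cfcₙ (fun t : ℝ => max (t - ε) 0 * t * max (t - ε) 0
          - ε • (max (t - ε) 0 * max (t - ε) 0)) a := by
      rw [cfcₙ_sub _ _ a (by fun_prop) (by simp) (by fun_prop) (by simp [hε.le]),
        cfcₙ_smul _ _ a (by fun_prop) (by simp [hε.le]),
        cfcₙ_mul _ _ a (by fun_prop) (by simp) (by fun_prop) (by simp [hε.le]),
        cfcₙ_mul _ _ a (by fun_prop) (by simp [hε.le]) (by fun_prop) (by simp),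
        cfcₙ_mul _ _ a (by fun_prop) (by simp [hε.le]) (by fun_prop) (by simp [hε.le]), cfcₙ_id' ℝ a]
    rw [heq, ← cfcₙ_smul _ _ a (by fun_prop) (by simp [hε.le])]
    refine cfcₙ_mono (fun t _ => ?_) (by fun_prop) (by fun_prop) (by simp [hε.le])
      (by simp [hε.le])
    simp only [smul_eq_mul]
    rcases max_cases (t - ε) 0 with ⟨h, h'⟩ | ⟨h, h'⟩ <;>
      rcases max_cases (t - (ε + ε)) 0 with ⟨k, k'⟩ | ⟨k, k'⟩ <;> rw [h, k]
    · have : ε ^ 2 ≤ (t - ε) ^ 2 := by nlinarith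
      nlinarith [mul_le_mul this (show t - (ε + ε) ≤ t - ε by linarith) k' (sq_nonneg _)]
    · nlinarith [mul_nonneg (sq_nonneg (t - ε)) h']
    · linarith
    · simp
  calc _ ≤ _ := h2
    _ ≤ cutDown ε a * a * cutDown ε a - cutDown ε a * (a - c) * cutDown ε a :=
      sub_le_sub_left h1 _
    _ = _ := by noncomm_ring

lemma cutDown_le_smul_conjugate {a c : B} (ha : 0 ≤ a) (hc : IsSelfAdjoint c) {ε : ℝ}
    (hε : 0 < ε) (h : ‖a - c‖ ≤ ε / 2) :
    cutDown ε a ≤ ((ε / 2) ^ 2)⁻¹ • (cutDown (ε / 2) a * c * cutDown (ε / 2) a) := by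
  have := smul_cutDown_le_conjugate ha hc (half_pos hε) h
  rw [add_halves] at this
  simpa [smul_smul, hε.ne'] using
    smul_le_smul_of_nonneg_left this (inv_nonneg.2 (sq_nonneg (ε / 2)))

lemma cutDown_mul_cutDown_le {a : B} (ha : 0 ≤ a) {ε : ℝ} (hε : 0 ≤ ε) :
    cutDown ε a * cutDown ε a ≤ ‖a‖ • a := by
  nth_rw 4 [← cfcₙ_id' ℝ a]
  rw [← cfcₙ_mul _ _ a (by fun_prop) (by simp [hε]) (by fun_prop) (by simp [hε]),
    ← cfcₙ_smul _ _ a (by fun_prop) (by simp)]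
  refine cfcₙ_mono fun t ht => ?_
  have ht' : 0 ≤ t := quasispectrum_nonneg_of_nonneg _ ha t ht
  have hta : t ≤ ‖a‖ := (le_abs_self t).trans 
    (NonUnitalIsometricContinuousFunctionalCalculus.norm_quasispectrum_le a ht ha.isSelfAdjoint)
  simp only [smul_eq_mul]
  have : max (t - ε) 0 ≤ t := max_le (by linarith) ht'
  nlinarith [mul_le_mul this this (le_max_right _ _) ht', mul_le_mul_of_nonneg_right hta ht']

end CuntzComparison

namespace IsCuntzSemigroupOf

variable {A S : Type*} [NonUnitalCStarAlgebra A] [CuSemigroup S]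

lemma cls_le_of_le_smul (hS : IsCuntzSemigroupOf A S) [PartialOrder hS.stab]
    [StarOrderedRing hS.stab] {x y : hS.stab} {K : ℝ} (hx : 0 ≤ x) (hy : 0 ≤ y) (h : x ≤ K • y) :
    hS.cls x ≤ hS.cls y :=
  (hS.cls_le_iff x y (cStarNonneg_iff.2 hx) (cStarNonneg_iff.2 hy)).2
    (cuntzBelow_of_le_smul hx hy h)

lemma cls_conjugate_le (hS : IsCuntzSemigroupOf A S) [PartialOrder hS.stab]
    [StarOrderedRing hS.stab] {b : hS.stab}
    (hb : 0 ≤ b) (r : hS.stab) : hS.cls (r * b * star r) ≤ hS.cls b :=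
  (hS.cls_le_iff _ b (cStarNonneg_iff.2 (star_right_conjugate_nonneg hb r))
    (cStarNonneg_iff.2 hb)).2 (cuntzBelow_conjugate b r)

lemma cls_star_mul_self_le (hS : IsCuntzSemigroupOf A S) [PartialOrder hS.stab]
    [StarOrderedRing hS.stab] (x : hS.stab) :
    hS.cls (star x * x) ≤ hS.cls (x * star x) :=
  (hS.cls_le_iff _ _ (cStarNonneg_iff.2 (star_mul_self_nonneg x))
    (cStarNonneg_iff.2 (mul_star_self_nonneg x))).2 (cuntzBelow_star_mul_self x)

lemma exists_orthogonal_reps (hS : IsCuntzSemigroupOf A S) [PartialOrder hS.stab]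
    [StarOrderedRing hS.stab] (p q : S) :
    ∃ a b : hS.stab, 0 ≤ a ∧ 0 ≤ b ∧ a * b = 0 ∧ hS.cls a = p ∧ hS.cls b = q := by
  obtain ⟨a₀, ha₀, rfl⟩ := hS.cls_surj p
  obtain ⟨b₀, hb₀, rfl⟩ := hS.cls_surj q
  obtain ⟨a, b, ha, hb, h⟩ := hS.exists_orth a₀ b₀ ha₀ hb₀
  exact ⟨a, b, cStarNonneg_iff.1 ha, cStarNonneg_iff.1 hb, h⟩

theorem addContinuous (hS : IsCuntzSemigroupOf A S) : CuDiv.AddContinuous S := by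
  let _ := CStarAlgebra.spectralOrder hS.stab
  have := CStarAlgebra.spectralOrderedRing hS.stab
  intro w p q hw
  obtain ⟨a, b, ha, hb, hab, rfl, rfl⟩ := hS.exists_orthogonal_reps p q
  have hac := cStarNonneg_iff.2 ha
  have hbc := cStarNonneg_iff.2 hb
  rw [← hS.cls_add_orth a b hac hbc hab, hS.waybelow_iff _ _ (cStarNonneg_iff.2 (add_nonneg ha hb))]
    at hw
  obtain ⟨ε, hε, hw⟩ := hw
  have hδ : 0 < ε / 4 := by positivity
  have ha' := cutDown_nonneg (ε / 4) a
  have hb' := cutDown_nonneg (ε / 4) b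
  refine ⟨hS.cls (cutDown (ε / 4) a), hS.cls (cutDown (ε / 4) b),
    (hS.waybelow_iff _ _ hac).2 ⟨ε / 4, hδ, le_rfl⟩,
    (hS.waybelow_iff _ _ hbc).2 ⟨ε / 4, hδ, le_rfl⟩, hw.trans ?_⟩
  rw [← hS.cls_add_orth _ _ (cStarNonneg_iff.2 ha') (cStarNonneg_iff.2 hb')
    (cutDown_mul_cutDown ha.isSelfAdjoint hb.isSelfAdjoint hab hδ hδ)]
  have hc := add_nonneg ha' hb'
  have hnorm : ‖a + b - (cutDown (ε / 4) a + cutDown (ε / 4) b)‖ ≤ ε / 2 := by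
    rw [add_sub_add_comm]
    linarith [norm_add_le (a - cutDown (ε / 4) a) (b - cutDown (ε / 4) b),
      norm_sub_cutDown_le ha hδ.le, norm_sub_cutDown_le hb hδ.le]
  have hp := (cutDown_nonneg (ε / 2) (a + b)).isSelfAdjoint
  have hle := cutDown_le_smul_conjugate (add_nonneg ha hb) hc.isSelfAdjoint hε hnorm
  have hconj := hS.cls_conjugate_le hc (cutDown (ε / 2) (a + b))
  have hnn := star_right_conjugate_nonneg hc (cutDown (ε / 2) (a + b))
  rw [hp.star_eq] at hconj hnn
  exact (hS.cls_le_of_le_smul (cutDown_nonneg _ _) hnn hle).trans hconj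

/-- If `p' ≪ [a] ≤ [b]`, then `p'` is dominated by the class of `star z * z` for some
`z = (a - η)₊ * r * √b`. -/
lemma exists_le_cls_star_mul_self (hS : IsCuntzSemigroupOf A S) [PartialOrder hS.stab]
    [StarOrderedRing hS.stab] {p' : S} {a b : hS.stab} (ha : 0 ≤ a) (hb : 0 ≤ b)
    (hp : WayBelow p' (hS.cls a)) (hab : hS.cls a ≤ hS.cls b) :
    ∃ (η K : ℝ) (r z : hS.stab), 0 < η ∧ 0 ≤ K ∧ z = cutDown η a * r * CFC.sqrt b ∧
      p' ≤ hS.cls (star z * z) ∧ z * star z ≤ K • a := by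
  have hac := cStarNonneg_iff.2 ha
  obtain ⟨ε, hε, hp'⟩ := (hS.waybelow_iff _ _ hac).1 hp
  obtain ⟨r, hr⟩ := (hS.cls_le_iff _ _ hac (cStarNonneg_iff.2 hb)).1 hab
  obtain ⟨n, hn⟩ := ((tendsto_iff_norm_sub_tendsto_zero.1 hr).eventually
    (ge_mem_nhds (half_pos hε))).exists
  rw [norm_sub_rev] at hn
  have hc : IsSelfAdjoint (r n * b * star (r n)) :=
    (star_right_conjugate_nonneg hb (r n)).isSelfAdjoint
  have hps := (cutDown_nonneg (ε / 2) a).isSelfAdjoint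
  set z := cutDown (ε / 2) a * r n * CFC.sqrt b with hz
  have hzz : z * star z = cutDown (ε / 2) a * (r n * b * star (r n)) * cutDown (ε / 2) a := by
    rw [hz, star_mul, star_mul, hps.star_eq, (CFC.sqrt_nonneg b).isSelfAdjoint.star_eq]
    nth_rw 3 [← CFC.sqrt_mul_sqrt_self b hb]
    noncomm_ring
  refine ⟨ε / 2, ‖r n * b * star (r n)‖ * ‖a‖, r n, z, half_pos hε, by positivity, rfl, ?_, ?_⟩
  · have hle := cutDown_le_smul_conjugate ha hc hε hn
    rw [← hzz] at hle
    refine (hp'.trans (hS.cls_le_of_le_smul (cutDown_nonneg _ _) (mul_star_self_nonneg z) hle)).trans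
      ?_
    simpa using hS.cls_star_mul_self_le (star z)
  · have hle := CStarAlgebra.star_left_conjugate_le_norm_smul (a := cutDown (ε / 2) a) (hb := hc)
    rw [hps.star_eq, ← hzz] at hle
    rw [mul_smul]
    exact hle.trans (smul_le_smul_of_nonneg_left
      (cutDown_mul_cutDown_le ha (half_pos hε).le) (norm_nonneg _))

theorem almostBounded (hS : IsCuntzSemigroupOf A S) : CuDiv.AlmostBounded S := by
  let _ := CStarAlgebra.spectralOrder hS.stab
  have := CStarAlgebra.spectralOrderedRing hS.stab
  intro p' p q' q w hp hq hpw hqw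
  obtain ⟨a₁, a₂, ha₁, ha₂, ha, rfl, rfl⟩ := hS.exists_orthogonal_reps p q
  obtain ⟨b, hb, rfl⟩ := hS.cls_surj w
  rw [cStarNonneg_iff] at hb
  obtain ⟨η₁, K₁, r₁, z₁, hη₁, hK₁, hz₁, hp', hle₁⟩ := hS.exists_le_cls_star_mul_self ha₁ hb hp hpw
  obtain ⟨η₂, K₂, r₂, z₂, hη₂, hK₂, hz₂, hq', hle₂⟩ := hS.exists_le_cls_star_mul_self ha₂ hb hq hqw
  have horth : star z₁ * z₂ = 0 := by
    have h := cutDown_mul_cutDown ha₁.isSelfAdjoint ha₂.isSelfAdjoint ha hη₁ hη₂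
    rw [hz₁, hz₂, star_mul, star_mul, (cutDown_nonneg η₁ a₁).isSelfAdjoint.star_eq]
    calc _ = star (CFC.sqrt b) * (star r₁ * (cutDown η₁ a₁ * cutDown η₂ a₂) * r₂) * CFC.sqrt b := by
          noncomm_ring
      _ = 0 := by simp [h]
  have horth' : star z₂ * z₁ = 0 := by simpa using congrArg star horth
  have hsum : star (z₁ + z₂) * (z₁ + z₂) = star z₁ * z₁ + star z₂ * z₂ := by
    simp [add_mul, mul_add, horth, horth']
  have hge : ∀ z, star z * z ≤ star (z₁ + z₂) * (z₁ + z₂) →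
      hS.cls (star z * z) ≤ hS.cls ((z₁ + z₂) * star (z₁ + z₂)) := fun z hz =>
    (hS.cls_le_of_le_smul (K := 1) (star_mul_self_nonneg z) (star_mul_self_nonneg (z₁ + z₂))
      (by simpa using hz)).trans (hS.cls_star_mul_self_le (z₁ + z₂))
  refine ⟨hS.cls ((z₁ + z₂) * star (z₁ + z₂)), hp'.trans (hge _ ?_), hq'.trans (hge _ ?_), ?_, ?_⟩
  · rw [hsum]
    exact le_add_of_nonneg_right (star_mul_self_nonneg z₂)
  · rw [hsum]
    exact le_add_of_nonneg_left (star_mul_self_nonneg z₁)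
  · have heq : (z₁ + z₂) * star (z₁ + z₂) = (cutDown η₁ a₁ * r₁ + cutDown η₂ a₂ * r₂) * b *
        star (cutDown η₁ a₁ * r₁ + cutDown η₂ a₂ * r₂) := by
      rw [hz₁, hz₂, ← add_mul, star_mul, (CFC.sqrt_nonneg b).isSelfAdjoint.star_eq, mul_assoc,
        ← mul_assoc (CFC.sqrt b), CFC.sqrt_mul_sqrt_self b hb, mul_assoc]
    rw [heq]
    exact hS.cls_conjugate_le hb _
  · rw [← hS.cls_add_orth _ _ (cStarNonneg_iff.2 ha₁) (cStarNonneg_iff.2 ha₂) ha]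
    refine hS.cls_le_of_le_smul (K := 2 * (K₁ + K₂)) (mul_star_self_nonneg _)
      (add_nonneg ha₁ ha₂) ?_
    have h₁ : K₁ • a₁ ≤ (K₁ + K₂) • a₁ :=
      smul_le_smul_of_nonneg_right (le_add_of_nonneg_right hK₂) ha₁
    have h₂ : K₂ • a₂ ≤ (K₁ + K₂) • a₂ :=
      smul_le_smul_of_nonneg_right (le_add_of_nonneg_left hK₁) ha₂
    calc (z₁ + z₂) * star (z₁ + z₂)
        ≤ (z₁ + z₂) * star (z₁ + z₂) + (z₁ - z₂) * star (z₁ - z₂) :=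
          le_add_of_nonneg_right (mul_star_self_nonneg _)
      _ = (2 : ℝ) • (z₁ * star z₁ + z₂ * star z₂) := by
          rw [two_smul, star_add, star_sub]
          noncomm_ring
      _ ≤ (2 : ℝ) • ((K₁ + K₂) • a₁ + (K₁ + K₂) • a₂) :=
          smul_le_smul_of_nonneg_left (add_le_add (hle₁.trans h₁) (hle₂.trans h₂)) zero_le_two
      _ = (2 * (K₁ + K₂)) • (a₁ + a₂) := by rw [mul_smul, smul_add (K₁ + K₂)]

end IsCuntzSemigroupOf

/-- Proposition 4.9.  Let `A` be a separable C*-algebra with the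
Global Glimm Property whose Cuntz semigroup is left-soft separative, and let `σ` be the
map sending each `x ∈ Cu(A)` to the largest strongly soft element dominated by `x`.
Then `wdiv_m(σ(x)) - 1 ≤ wdiv_m(x) ≤ wdiv_m(σ(x)) + 1`. -/
theorem wdiv_soft_comparison
    (A : Type) [NonUnitalCStarAlgebra A] (S : Type) [CuSemigroup S]
    (hS : IsCuntzSemigroupOf A S)
    (hsep : TopologicalSpace.SeparableSpace A)
    (hggp : CuDiv.GlobalGlimm S)
    (hlss : CuDiv.LeftSoftSeparative S)
    (sigma : S → S)
    (hsigma : ∀ x : S, CuDiv.StronglySoft (sigma x) ∧ sigma x ≤ x ∧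
      ∀ z : S, CuDiv.StronglySoft z → z ≤ x → z ≤ sigma x)
    (x : S) (m : ℕ) (hm : 2 ≤ m) :
    CuDiv.wdiv m (sigma x) - 1 ≤ CuDiv.wdiv m x ∧
      CuDiv.wdiv m x ≤ CuDiv.wdiv m (sigma x) + 1 := by
  have hcont := hS.addContinuous
  have hm0 : m ≠ 0 := by omega
  exact ⟨tsub_le_iff_right.2 (CuDiv.wdiv_le_wdiv_add_one fun _ =>
      hcont.isWeaklyDivisible_soft hS.almostBounded hggp hsigma hm0),
    CuDiv.wdiv_le_wdiv_add_one fun _ => hcont.isWeaklyDivisible_of_soft hggp hsigma hm0⟩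
end
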